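/- arXiv:0901.2392 — 2 statements merged into one kernel-verified Lean document; each statement's English description precedes it below -/
import Mathlib

section
/- Let (R,m) be a regular local ring of Krull dimension at least 1 and let α₁,…,α_k ∈ ℤ^N_{≥0} be nonzero multi-indices with |α₁| ≥ |α₂| ≥ … ≥ |α_k|. Let s = min{ i : supp(α_i) does not contain supp(α_j) for every j > i } (this set is nonempty since i = k belongs to it vacuously). Then for every n ≥ 1 the Artin function of the system (X^{α₁},…,X^{α_k}) satisfies β_n(X^{α₁},…,X^{α_k}) = |α_s| n − |α_s| + 1. Explicitly: (a) every a ∈ R^N with a^{αᵢ} ∈ m^{|α_s|n − |α_s| + 1} for all i admits b ∈ R^N with b^{αᵢ} = 0 for all i and a ≡ b (mod m^n R^N); and (b) there exists a ∈ R^N with a^{αᵢ} ∈ m^{|α_s|n − |α_s|} for all i such that no b ∈ R^N with b^{αᵢ} = 0 for all i satisfies a ≡ b (mod m^n R^N). -/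
open IsLocalRing

/-- A Noetherian local ring is regular if its maximal ideal is generated by
`Krull dimension`-many elements. -/
def IsRegularLocal (R : Type*) [CommRing R] [IsLocalRing R] : Prop :=
  IsNoetherianRing R ∧ ∃ s : Finset R, Ideal.span (s : Set R) = maximalIdeal R ∧
    (s.card : WithBot ℕ∞) = ringKrullDim R

/-- Polynomials all of whose coefficients lie in the prime `p`. -/
noncomputable def extPrime (σ : Type*) {R : Type*} [CommRing R] (p : PrimeSpectrum R) :
    PrimeSpectrum (MvPolynomial σ R) :=
  ⟨RingHom.ker (MvPolynomial.map (σ := σ) (Ideal.Quotient.mk p.asIdeal)), RingHom.ker_isPrime _⟩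

lemma mem_extPrime {σ R : Type*} [CommRing R] (p : PrimeSpectrum R) (f : MvPolynomial σ R) :
    f ∈ (extPrime σ p).asIdeal ↔ ∀ c, f.coeff c ∈ p.asIdeal := by
  simp only [extPrime, RingHom.mem_ker, MvPolynomial.ext_iff, MvPolynomial.coeff_map,
    MvPolynomial.coeff_zero, Ideal.Quotient.eq_zero_iff_mem]

lemma C_mem_extPrime {σ R : Type*} [CommRing R] (p : PrimeSpectrum R) (r : R) :
    MvPolynomial.C r ∈ (extPrime σ p).asIdeal ↔ r ∈ p.asIdeal := by
  simp only [extPrime, RingHom.mem_ker, MvPolynomial.map_C, map_eq_zero_iff _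
    (MvPolynomial.C_injective σ _), Ideal.Quotient.eq_zero_iff_mem]

lemma X_notMem_extPrime {σ R : Type*} [CommRing R] (p : PrimeSpectrum R) (i : σ) :
    MvPolynomial.X i ∉ (extPrime σ p).asIdeal := by
  rw [mem_extPrime]
  intro h
  have h1 := h (Finsupp.single i 1)
  classical
  rw [MvPolynomial.coeff_X, if_pos rfl] at h1
  exact p.2.ne_top ((Ideal.eq_top_iff_one _).2 h1)

lemma extPrime_strictMono (σ : Type*) {R : Type*} [CommRing R] :
    StrictMono (extPrime σ : PrimeSpectrum R → _) := by
  apply Monotone.strictMono_of_injective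
  · intro p q hpq f hf
    rw [mem_extPrime] at hf ⊢
    exact fun c => hpq (hf c)
  · intro p q h
    ext r
    rw [← C_mem_extPrime (σ := σ), h, C_mem_extPrime]

lemma height_le_height_extPrime (σ : Type*) {R : Type*} [CommRing R] (p : PrimeSpectrum R) :
    p.asIdeal.height ≤ (extPrime σ p).asIdeal.height := by
  rw [PrimeSpectrum.height_eq_orderHeight, PrimeSpectrum.height_eq_orderHeight]
  exact Order.height_le_height_apply_of_strictMono _ (extPrime_strictMono σ) p

lemma exists_form {R σ : Type*} [CommRing R] (x : σ → R) (e : ℕ) :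
    ∀ a ∈ Ideal.span (Set.range x) ^ e, ∃ A : MvPolynomial σ R,
      A.IsHomogeneous e ∧ MvPolynomial.aeval x A = a := by
  let J : ℕ → Ideal R := fun e =>
    (MvPolynomial.homogeneousSubmodule σ R e).map (MvPolynomial.aeval x).toLinearMap
  have key : Ideal.span (Set.range x) ^ e ≤ J e := by
    induction e with
    | zero =>
      intro a _
      exact ⟨MvPolynomial.C a, MvPolynomial.isHomogeneous_C _ _, by simp⟩
    | succ e ih =>
      have h1 : Ideal.span (Set.range x) ≤ J 1 := by
        rw [Ideal.span_le]
        rintro _ ⟨i, rfl⟩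
        exact ⟨MvPolynomial.X i, MvPolynomial.isHomogeneous_X _ _, by simp⟩
      rw [pow_succ, Ideal.mul_le]
      intro a ha b hb
      obtain ⟨A, hA, rfl⟩ := ih ha
      obtain ⟨B, hB, rfl⟩ := h1 hb
      exact ⟨A * B, MvPolynomial.IsHomogeneous.mul hA hB, by simp⟩
  intro a ha
  obtain ⟨A, hA, h⟩ := key ha
  exact ⟨A, hA, h⟩

lemma aeval_form_mem {R σ : Type*} [CommRing R] (x : σ → R) (e : ℕ) (m : Ideal R)
    (hx : ∀ i, x i ∈ m) (A : MvPolynomial σ R) (hA : A.IsHomogeneous e)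
    (hc : ∀ c, A.coeff c ∈ m) : MvPolynomial.aeval x A ∈ m ^ (e + 1) := by
  rw [MvPolynomial.aeval_def, MvPolynomial.eval₂_eq]
  refine Ideal.sum_mem _ fun c hcs => ?_
  rw [pow_succ']
  refine Ideal.mul_mem_mul (hc c) ?_
  have hd : ∑ i ∈ c.support, c i = e := by
    have := hA (MvPolynomial.mem_support_iff.1 hcs)
    rw [Finsupp.weight_apply] at this
    simpa [Finsupp.sum] using this
  rw [← hd, ← Finset.prod_pow_eq_pow_sum]
  exact Ideal.prod_mem_prod fun i _ => Ideal.pow_mem_pow (hx i) _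

lemma aeval_scale {R S σ : Type*} [CommRing R] [CommRing S] [Algebra R S] (x : σ → S) (t : S)
    (e : ℕ) (A : MvPolynomial σ R) (hA : A.IsHomogeneous e) :
    MvPolynomial.aeval (fun i => t * x i) A = t ^ e * MvPolynomial.aeval x A := by
  simp only [MvPolynomial.aeval_def, MvPolynomial.eval₂_eq, Finset.mul_sum]
  refine Finset.sum_congr rfl fun c hcs => ?_
  have hd : ∑ i ∈ c.support, c i = e := by
    have := hA (MvPolynomial.mem_support_iff.1 hcs)
    rw [Finsupp.weight_apply] at this
    simpa [Finsupp.sum] using this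
  simp only [mul_pow, Finset.prod_mul_distrib, Finset.prod_pow_eq_pow_sum, hd]
  ring

section
open MvPolynomial

/-- The key point: the associated graded ring is a polynomial ring. -/
lemma form_coeff_mem {R : Type*} [CommRing R] [IsLocalRing R] [IsNoetherianRing R]
    (t : Finset R) (ht : Ideal.span (t : Set R) = maximalIdeal R)
    (hcard : (t.card : WithBot ℕ∞) = ringKrullDim R) (hne : t.Nonempty)
    (e : ℕ) (F : MvPolynomial t R) (hF : F.IsHomogeneous e)
    (hFx : aeval (fun i : t => (i : R)) F ∈ maximalIdeal R ^ (e + 1)) :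
    ∀ c, F.coeff c ∈ maximalIdeal R := by
  classical
  let x : t → R := fun i => (i : R)
  have hrange : Ideal.span (Set.range x) = maximalIdeal R := by
    rw [← ht]; congr 1; simp [x]
  by_contra hcon
  obtain ⟨x0, hx0⟩ := hne
  let i0 : t := ⟨x0, hx0⟩
  let pm : PrimeSpectrum R := ⟨maximalIdeal R, inferInstance⟩
  let Q := extPrime t pm
  have hFQ : F ∉ Q.asIdeal := by
    rw [mem_extPrime]; exact hcon
  obtain ⟨G, hG, hGx⟩ := exists_form x (e + 1) (aeval x F) (by rw [hrange]; exact hFx)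
  let y : t → MvPolynomial t R := fun i => X i0 * C (x i) - C (x i0) * X i
  let Y : Finset (MvPolynomial t R) := (Finset.univ.erase i0).image y
  have hYcard : Y.card < t.card := by
    calc Y.card ≤ (Finset.univ.erase i0).card := Finset.card_image_le
      _ < (Finset.univ : Finset t).card := Finset.card_erase_lt_of_mem (Finset.mem_univ _)
      _ = t.card := by simp
  have hCQ : ∀ i, C (x i) ∈ Q.asIdeal := fun i => by
    rw [C_mem_extPrime]
    change x i ∈ maximalIdeal R
    rw [← hrange]
    exact Ideal.subset_span ⟨i, rfl⟩
  have hmin : Q.asIdeal ∈ (Ideal.span (Y : Set (MvPolynomial t R))).minimalPrimes := by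
    refine ⟨⟨Q.2, ?_⟩, ?_⟩
    · rw [Ideal.span_le]
      intro z hz
      obtain ⟨i, _, rfl⟩ := Finset.mem_image.1 (Finset.mem_coe.1 hz)
      exact sub_mem (Ideal.mul_mem_left _ _ (hCQ i)) (Ideal.mul_mem_right _ _ (hCQ i0))
    · rintro P ⟨hP, hYP⟩ hPQ
      have hy : ∀ i, y i ∈ P := by
        intro i
        by_cases hi : i = i0
        · subst hi
          have : y i0 = 0 := by simp only [y]; ring
          rw [this]; exact zero_mem _
        · exact hYP (Ideal.subset_span (Finset.mem_coe.2 (Finset.mem_image.2 ⟨i, by simp [hi], rfl⟩)))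
      let π : MvPolynomial t R →ₐ[R] (MvPolynomial t R ⧸ P) := Ideal.Quotient.mkₐ R P
      have hrel : ∀ i, π (X i0) * π (C (x i)) = π (C (x i0)) * π (X i) := by
        intro i
        rw [← map_mul, ← map_mul, ← sub_eq_zero, ← map_sub]
        exact Ideal.Quotient.eq_zero_iff_mem.2 (hy i)
      have hgen : ∀ (e : ℕ) (A : MvPolynomial t R), A.IsHomogeneous e →
          π (X i0) ^ e * π (C (aeval x A)) = π (C (x i0)) ^ e * π A := by
        intro e A hA
        have h1 := aeval_scale (fun i => π (C (x i))) (π (X i0)) e A hA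
        have h2 := aeval_scale (fun i => π (X i)) (π (C (x i0))) e A hA
        have h3 : aeval (fun i => π (X i)) A = π A := by
          exact (DFunLike.congr_fun (MvPolynomial.aeval_unique π) A).symm
        have h4 : aeval (fun i => π (C (x i))) A = π (C (aeval x A)) := by
          have := MvPolynomial.aeval_algebraMap_apply (MvPolynomial t R ⧸ P) x A
          exact this
        rw [← h3, ← h4, ← h1, ← h2]
        simp only [hrel]
      have e1 := hgen e F hF
      have e2 := hgen (e + 1) G hG
      rw [hGx] at e2
      have e3 : π (C (x i0) ^ e * (X i0 * F - C (x i0) * G)) = 0 := by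
        simp only [map_mul, map_sub, map_pow]
        linear_combination -(π (X i0)) * e1 + e2
      have e4 : C (x i0) ^ e * (X i0 * F - C (x i0) * G) ∈ P := Ideal.Quotient.eq_zero_iff_mem.1 e3
      have hn : X i0 * F - C (x i0) * G ∉ P := by
        intro h
        have h' := add_mem (hPQ h) (Ideal.mul_mem_right G _ (hCQ i0))
        rw [sub_add_cancel] at h'
        rcases Q.2.mem_or_mem h' with h | h
        · exact X_notMem_extPrime _ _ h
        · exact hFQ h
      have hx0P : C (x i0) ∈ P := hP.mem_of_pow_mem _ ((hP.mem_or_mem e4).resolve_right hn)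
      have hxP : ∀ i, C (x i) ∈ P := by
        intro i
        have h := add_mem (hy i) (Ideal.mul_mem_right (X i) _ hx0P)
        simp only [y, sub_add_cancel] at h
        exact (hP.mem_or_mem h).resolve_left fun h => X_notMem_extPrime _ _ (hPQ h)
      have hmP : maximalIdeal R ≤ P.comap C := by
        rw [← hrange, Ideal.span_le]
        rintro _ ⟨i, rfl⟩
        exact hxP i
      intro f hf
      rw [mem_extPrime] at hf
      rw [MvPolynomial.as_sum f]
      refine Ideal.sum_mem _ fun c _ => ?_
      rw [← mul_one (coeff c f), ← C_mul_monomial]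
      exact Ideal.mul_mem_right _ _ (hmP (hf c))
  have hle := Ideal.height_le_card_of_mem_minimalPrimes_span_finset hmin
  have h2 := (height_le_height_extPrime t pm).trans hle
  have h3 : ((maximalIdeal R).height : WithBot ℕ∞) ≤ ((Y.card : ℕ∞) : WithBot ℕ∞) :=
    WithBot.coe_le_coe.2 h2
  rw [IsLocalRing.maximalIdeal_height_eq_ringKrullDim, ← hcard] at h3
  have h4 : t.card ≤ Y.card := by exact_mod_cast h3
  omega

lemma exists_unit_form {R : Type*} [CommRing R] [IsLocalRing R]
    (t : Finset R) (ht : Ideal.span (t : Set R) = maximalIdeal R) (p : ℕ) (a : R)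
    (ha : a ∉ maximalIdeal R ^ (p + 1)) : ∃ q ≤ p, ∃ A : MvPolynomial t R,
      A.IsHomogeneous q ∧ aeval (fun i : t => (i : R)) A = a ∧
      ¬ ∀ c, A.coeff c ∈ maximalIdeal R := by
  classical
  have hex : ∃ q, a ∉ maximalIdeal R ^ (q + 1) := ⟨p, ha⟩
  refine ⟨Nat.find hex, Nat.find_min' hex ha, ?_⟩
  have h1 : a ∉ maximalIdeal R ^ (Nat.find hex + 1) := Nat.find_spec hex
  have h2 : a ∈ maximalIdeal R ^ (Nat.find hex) := by
    rcases h : Nat.find hex with _ | q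
    · simp
    · have := Nat.find_min hex (m := q) (by omega)
      simpa using this
  have hrange : Ideal.span (Set.range fun i : t => (i : R)) = maximalIdeal R := by
    rw [← ht]; congr 1; simp
  obtain ⟨A, hA, hAx⟩ := exists_form (fun i : t => (i : R)) _ a (by rw [hrange]; exact h2)
  refine ⟨A, hA, hAx, fun hc => h1 ?_⟩
  have h3 := aeval_form_mem (fun i : t => (i : R)) _ (maximalIdeal R) (fun i => ?_) A hA hc
  · rwa [hAx] at h3
  rw [← hrange]
  exact Ideal.subset_span ⟨i, rfl⟩

lemma mul_notMem_pow {R : Type*} [CommRing R] [IsLocalRing R] [IsNoetherianRing R]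
    (t : Finset R) (ht : Ideal.span (t : Set R) = maximalIdeal R)
    (hcard : (t.card : WithBot ℕ∞) = ringKrullDim R) (hne : t.Nonempty)
    (p q : ℕ) (a b : R) (ha : a ∉ maximalIdeal R ^ (p + 1)) (hb : b ∉ maximalIdeal R ^ (q + 1)) :
    a * b ∉ maximalIdeal R ^ (p + q + 1) := by
  intro hab
  obtain ⟨p', hp, A, hA, hAx, hA'⟩ := exists_unit_form t ht p a ha
  obtain ⟨q', hq, B, hB, hBx, hB'⟩ := exists_unit_form t ht q b hb
  have h := form_coeff_mem t ht hcard hne (p' + q') (A * B) (hA.mul hB) (by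
    rw [map_mul, hAx, hBx]
    exact Ideal.pow_le_pow_right (by omega) hab)
  let pm : PrimeSpectrum R := ⟨maximalIdeal R, inferInstance⟩
  rcases (extPrime t pm).2.mem_or_mem ((mem_extPrime pm (A * B)).2 h) with h | h
  · exact hA' ((mem_extPrime pm A).1 h)
  · exact hB' ((mem_extPrime pm B).1 h)

end

lemma pow_notMem_of_mul {R : Type*} [CommRing R] (m : Ideal R) (hm : m ≠ ⊤)
    (H : ∀ (p q : ℕ) (a b : R), a ∉ m ^ (p + 1) → b ∉ m ^ (q + 1) → a * b ∉ m ^ (p + q + 1))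
    (p : ℕ) (a : R) (ha : a ∉ m ^ (p + 1)) (r : ℕ) : a ^ r ∉ m ^ (r * p + 1) := by
  induction r with
  | zero => simpa using (Ideal.ne_top_iff_one m).1 hm
  | succ r ih =>
    have := H _ _ _ _ ih ha
    rwa [← pow_succ, ← Nat.succ_mul] at this

lemma prod_notMem_of_mul {R ι : Type*} [CommRing R] (m : Ideal R) (hm : m ≠ ⊤)
    (H : ∀ (p q : ℕ) (a b : R), a ∉ m ^ (p + 1) → b ∉ m ^ (q + 1) → a * b ∉ m ^ (p + q + 1))
    (p : ℕ) (a : ι → R) (r : ι → ℕ) (S : Finset ι)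
    (ha : ∀ j ∈ S, r j ≠ 0 → a j ∉ m ^ (p + 1)) :
    ∏ j ∈ S, a j ^ r j ∉ m ^ ((∑ j ∈ S, r j) * p + 1) := by
  classical
  induction S using Finset.induction_on with
  | empty => simpa using (Ideal.ne_top_iff_one m).1 hm
  | insert j S hj ih =>
    rw [Finset.prod_insert hj, Finset.sum_insert hj, add_mul]
    refine H _ _ _ _ ?_ (ih fun i hi => ha i (Finset.mem_insert_of_mem hi))
    by_cases hr : r j = 0
    · simpa [hr] using (Ideal.ne_top_iff_one m).1 hm
    · exact pow_notMem_of_mul m hm H p _ (ha j (Finset.mem_insert_self _ _) hr) _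

/-- **Theorem.** Let `(R, m)` be a regular local ring of Krull dimension at least `1` and
`α₁,…,α_k` nonzero multi-indices with `|α₁| ≥ ⋯ ≥ |α_k|`.  Let `s` be the least index such that
`supp(α_s)` contains `supp(α_j)` for no `j > s`.  Then for every `n ≥ 1`,
`β_n(X^{α₁},…,X^{α_k}) = |α_s| n − |α_s| + 1`: (a) every `a` with `a^{αᵢ} ∈ m^(|α_s|n−|α_s|+1)`
for all `i` is congruent mod `mⁿ` to a common zero `b` of the monomials, and (b) there is an
`a` with `a^{αᵢ} ∈ m^(|α_s|n−|α_s|)` for all `i` congruent mod `mⁿ` to no common zero. -/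
theorem monomial_ideal_artin_function_regular
    (R : Type*) [CommRing R] [IsLocalRing R] (hreg : IsRegularLocal R)
    (hdim : (1 : WithBot ℕ∞) ≤ ringKrullDim R)
    (N k : ℕ) (α : Fin k → Fin N → ℕ) (hα : ∀ i, α i ≠ 0)
    (hsort : ∀ i j : Fin k, i ≤ j → (∑ x, α j x) ≤ (∑ x, α i x))
    (s : Fin k)
    (hs : ∀ j : Fin k, s < j → ¬ ({x | α j x ≠ 0} ⊆ {x | α s x ≠ 0}))
    (hs' : ∀ i : Fin k, i < s → ∃ j : Fin k, i < j ∧ {x | α j x ≠ 0} ⊆ {x | α i x ≠ 0})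
    (n : ℕ) (hn : 1 ≤ n) :
    (∀ a : Fin N → R,
      (∀ i, (∏ j, a j ^ α i j) ∈ maximalIdeal R ^ ((∑ x, α s x) * n - (∑ x, α s x) + 1)) →
      ∃ b : Fin N → R, (∀ i, (∏ j, b j ^ α i j) = 0) ∧
        ∀ j, a j - b j ∈ maximalIdeal R ^ n) ∧
    (∃ a : Fin N → R,
      (∀ i, (∏ j, a j ^ α i j) ∈ maximalIdeal R ^ ((∑ x, α s x) * n - (∑ x, α s x))) ∧
      ∀ b : Fin N → R, (∀ i, (∏ j, b j ^ α i j) = 0) →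
        ∃ j, a j - b j ∉ maximalIdeal R ^ n) := by
  classical
  obtain ⟨hN, t, ht, hcard⟩ := hreg
  have hne : t.Nonempty := by
    rw [← Finset.card_pos]
    rw [← hcard] at hdim
    exact_mod_cast hdim
  have hm : maximalIdeal R ≠ ⊤ := Ideal.IsPrime.ne_top'
  have H := mul_notMem_pow t ht hcard hne
  obtain ⟨d, rfl⟩ : ∃ d, n = d + 1 := ⟨n - 1, by omega⟩
  have hexp : (∑ x, α s x) * (d + 1) - (∑ x, α s x) = (∑ x, α s x) * d := by
    rw [mul_add, mul_one, Nat.add_sub_cancel]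
  rw [hexp]
  have hpos : ∀ i, ∃ j, α i j ≠ 0 := fun i => Function.ne_iff.1 (hα i)
  constructor
  · intro a ha
    refine ⟨fun j => if a j ∈ maximalIdeal R ^ (d + 1) then 0 else a j, ?_, ?_⟩
    · have key : ∀ i, s ≤ i → ∃ j, α i j ≠ 0 ∧ a j ∈ maximalIdeal R ^ (d + 1) := by
        intro i hi
        by_contra! hcon
        refine prod_notMem_of_mul _ hm H d a (α i) Finset.univ (fun j _ h => hcon j h) ?_
        exact Ideal.pow_le_pow_right
          (Nat.succ_le_succ (Nat.mul_le_mul_right _ (hsort s i hi))) (ha i)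
      have key2 : ∀ (r : ℕ) (i : Fin k), k - i.1 = r →
          ∃ j, α i j ≠ 0 ∧ a j ∈ maximalIdeal R ^ (d + 1) := by
        intro r
        induction r using Nat.strong_induction_on with
        | _ r ih =>
          intro i hi
          rcases le_or_gt s i with h | h
          · exact key i h
          · obtain ⟨i', hlt, hsub⟩ := hs' i h
            have hlt' : i.1 < i'.1 := hlt
            obtain ⟨j, hj, haj⟩ := ih (k - i'.1) (by omega) i' rfl
            exact ⟨j, hsub hj, haj⟩
      intro i
      obtain ⟨j, hj, haj⟩ := key2 _ i rfl
      exact Finset.prod_eq_zero (Finset.mem_univ j) (by simp [haj, hj])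
    · intro j
      by_cases h : a j ∈ maximalIdeal R ^ (d + 1) <;> simp [h]
  · obtain ⟨x, hx⟩ := hne
    have hxm : x ∈ maximalIdeal R := by
      rw [← ht]; exact Ideal.subset_span hx
    have hx2 : x ∉ maximalIdeal R ^ (1 + 1) := by
      intro h
      have := form_coeff_mem t ht hcard ⟨x, hx⟩ 1 (MvPolynomial.X ⟨x, hx⟩)
        (MvPolynomial.isHomogeneous_X _ _) (by simpa using h) (Finsupp.single ⟨x, hx⟩ 1)
      rw [MvPolynomial.coeff_X, if_pos rfl] at this
      exact (Ideal.ne_top_iff_one _).1 hm this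
    have hxd : x ^ d ∉ maximalIdeal R ^ (d + 1) := by
      simpa using pow_notMem_of_mul _ hm H 1 x hx2 d
    have hbot : ∀ a : R, a ≠ 0 → ∃ p, a ∉ maximalIdeal R ^ (p + 1) := by
      intro a ha
      by_contra! hcon
      apply ha
      have hinf : a ∈ (⨅ i : ℕ, maximalIdeal R ^ i) := by
        rw [Ideal.mem_iInf]
        exact fun i => Ideal.pow_le_pow_right (Nat.le_succ i) (hcon i)
      rw [Ideal.iInf_pow_eq_bot_of_isLocalRing _ hm] at hinf
      simpa using hinf
    have hnz : NoZeroDivisors R := ⟨by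
      intro a b hab
      by_contra! hcon
      obtain ⟨p, hp⟩ := hbot a hcon.1
      obtain ⟨q, hq⟩ := hbot b hcon.2
      exact H p q a b hp hq (by rw [hab]; exact zero_mem _)⟩
    refine ⟨fun j => if α s j ≠ 0 then x ^ d else 0, ?_, ?_⟩
    · intro i
      by_cases hi : {x | α i x ≠ 0} ⊆ {x | α s x ≠ 0}
      · have his : i ≤ s := by
          by_contra! h
          exact hs i h hi
        have hprod : ∏ j, (if α s j ≠ 0 then x ^ d else 0) ^ α i j = x ^ (d * ∑ j, α i j) := by
          rw [pow_mul, ← Finset.prod_pow_eq_pow_sum]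
          refine Finset.prod_congr rfl fun j _ => ?_
          by_cases hj : α i j = 0
          · simp [hj]
          · have hj' : α s j ≠ 0 := hi hj
            rw [if_pos hj']
        rw [hprod, mul_comm d]
        exact Ideal.pow_le_pow_right (Nat.mul_le_mul_right _ (hsort i s his))
          (Ideal.pow_mem_pow hxm _)
      · obtain ⟨j, hj, hj'⟩ := Set.not_subset.1 hi
        have hz : ∏ j, (if α s j ≠ 0 then x ^ d else 0) ^ α i j = 0 := by
          refine Finset.prod_eq_zero (Finset.mem_univ j) ?_
          have hj2 : ¬ α s j ≠ 0 := hj'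
          rw [if_neg hj2, zero_pow hj]
        rw [hz]
        exact zero_mem _
    · intro b hb
      have hb' := hb s
      rw [Finset.prod_eq_zero_iff] at hb'
      obtain ⟨j, _, hj⟩ := hb'
      have hj0 : α s j ≠ 0 := by
        intro h
        rw [h, pow_zero] at hj
        exact one_ne_zero hj
      refine ⟨j, ?_⟩
      rw [eq_zero_of_pow_eq_zero hj]
      beta_reduce
      rw [if_pos hj0, sub_zero]
      exact hxd
end

section
/- Let (R,m) be a complete Noetherian local domain of Krull dimension 2 containing a field, let t ∈ R be nonzero, and let g ∈ R[X₁,…,X_N]. Then the single polynomial f = g(X₁,…,X_N) + tY ∈ R[X₁,…,X_N,Y] admits an Artin bound that is bounded above by a linear function of n: there exists a linear function β : ℕ → ℕ such that for every n ∈ ℕ and every (a, y) ∈ R^{N+1} with g(a) + ty ∈ m^{β(n)}, there exist (b, u) ∈ R^{N+1} with g(b) + tu = 0 and (a,y) ≡ (b,u) (mod m^n R^{N+1}). -/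
open MvPolynomial IsLocalRing

/-- Sequential completeness with respect to powers of an element. -/
def SeqComplete {A : Type*} [CommRing A] (w : A) : Prop :=
  ∀ u : ℕ → A, (∀ n, w ^ n ∣ u (n + 1) - u n) → ∃ l, ∀ n, w ^ n ∣ l - u n

lemma seq_dvd_of_le {A : Type*} [CommRing A] {w : A} {u : ℕ → A}
    (h : ∀ n, w ^ n ∣ u (n + 1) - u n) {m n : ℕ} (hmn : m ≤ n) : w ^ m ∣ u n - u m := by
  induction n, hmn using Nat.le_induction with
  | base => simp
  | succ n hmn ih =>
    have := dvd_add ((pow_dvd_pow w hmn).trans (h n)) ih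
    simpa using this

lemma eq_zero_of_forall_pow_dvd {A : Type*} [CommRing A] [IsDomain A] [IsDiscreteValuationRing A]
    {w : A} (hw : Irreducible w) {x : A} (h : ∀ n, w ^ n ∣ x) : x = 0 := by
  by_contra hx
  obtain ⟨n, v, hv⟩ := IsDiscreteValuationRing.eq_unit_mul_pow_irreducible hx hw
  have h1 := h (n + 1)
  rw [hv, mul_comm, pow_succ] at h1
  have h2 : w ∣ (v : A) := (mul_dvd_mul_iff_left (pow_ne_zero n hw.ne_zero)).1 h1
  exact hw.not_isUnit (isUnit_of_dvd_unit h2 v.isUnit)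

/-- quantitative Hensel -/
lemma hensel_quant {A : Type*} [CommRing A] [IsDomain A] [IsDiscreteValuationRing A]
    {w : A} (hw : Irreducible w) (hC : SeqComplete w) (F : Polynomial A) (a : A) (E m : ℕ)
    (hm : 1 ≤ m)
    (h1 : w ^ (2 * E + m) ∣ F.eval a) (h2 : ¬ w ^ E ∣ F.derivative.eval a) :
    ∃ b, F.eval b = 0 ∧ w ^ m ∣ a - b := by
  set d := F.derivative.eval a with hd
  have hd0 : d ≠ 0 := by rintro h; apply h2; rw [h]; exact dvd_zero _
  obtain ⟨k, v, hv⟩ := IsDiscreteValuationRing.eq_unit_mul_pow_irreducible hd0 hw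
  have hk : k < E := by
    by_contra hk
    apply h2; rw [hv]
    exact (pow_dvd_pow w (not_lt.1 hk)).mul_left _
  have h3 : d ^ 2 * w ^ m ∣ F.eval a := by
    refine dvd_trans ?_ h1
    have : d ^ 2 * w ^ m = (v ^ 2 : Aˣ) * w ^ (2 * k + m) := by
      rw [hv]; push_cast; ring
    rw [this, Units.mul_left_dvd]
    exact pow_dvd_pow w (by omega)
  obtain ⟨r, hr⟩ := h3
  -- F(a+dz) = F a + d * (d z) + H(z) (d z)^2
  obtain ⟨H, hH⟩ : ∃ H : Polynomial A, ∀ z, F.eval (a + d * z) = F.eval a + d * (d * z) + H.eval z * (d * z) ^ 2 := by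
    let G := F.comp (Polynomial.C a + Polynomial.X)
    refine ⟨(G.divX.divX).comp (Polynomial.C d * Polynomial.X), fun z => ?_⟩
    have e1 : G.eval (d * z) = F.eval (a + d * z) := by simp [G]
    have e2 : G.coeff 0 = F.eval a := by simp [G, Polynomial.coeff_zero_eq_eval_zero]
    have e3 : G.divX.coeff 0 = d := by
      have : G.divX.coeff 0 = G.coeff 1 := by simp [Polynomial.coeff_divX]
      rw [this]
      have h4 : G.coeff 1 = G.derivative.eval 0 := by
        rw [← Polynomial.coeff_zero_eq_eval_zero, Polynomial.coeff_derivative]; simp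
      rw [h4]
      simp [G, Polynomial.derivative_comp, hd]
    have e4 := congrArg (Polynomial.eval (d * z)) (Polynomial.divX_mul_X_add G)
    have e5 := congrArg (Polynomial.eval (d * z)) (Polynomial.divX_mul_X_add G.divX)
    simp only [Polynomial.eval_add, Polynomial.eval_mul, Polynomial.eval_X, Polynomial.eval_C] at e4 e5
    rw [← e1, ← e4, ← e5, e2, e3]
    simp
    ring
  let Φ : A → A := fun z => - (w ^ m * r) - H.eval z * z ^ 2
  let u : ℕ → A := fun n => Φ^[n] 0
  have hus : ∀ n, u (n + 1) = Φ (u n) := fun n => Function.iterate_succ_apply' _ _ _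
  have hum : ∀ n, w ^ m ∣ u n := by
    intro n
    induction n with
    | zero => simp [u]
    | succ n ih =>
      rw [hus]
      exact dvd_sub ((Dvd.intro _ rfl).neg_right) ((ih.trans (Dvd.intro_left _ (by ring : u n * u n = u n ^ 2))).mul_left _)
  have hwm : w ∣ w ^ m := dvd_pow_self w (by omega)
  have hcon : ∀ x y : A, w ∣ x → w ∣ y → ∀ n, w ^ n ∣ x - y → w ^ (n + 1) ∣ Φ x - Φ y := by
    intro x y hx hy n hn
    have hHd : x - y ∣ H.eval x - H.eval y := Polynomial.sub_dvd_eval_sub x y H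
    obtain ⟨q, hq⟩ := hHd
    have : Φ x - Φ y = (x - y) * -(q * x ^ 2 + H.eval y * (x + y)) := by
      simp only [Φ]
      linear_combination (-x^2) * hq
    rw [this, pow_succ]
    refine mul_dvd_mul hn (Dvd.dvd.neg_right (dvd_add ?_ ?_))
    · exact (hx.trans (dvd_pow_self x two_ne_zero)).mul_left _
    · exact (dvd_add hx hy).mul_left _
  have hcau : ∀ n, w ^ n ∣ u (n + 1) - u n := by
    intro n
    induction n with
    | zero => simp
    | succ n ih =>
      rw [hus (n + 1), hus n]
      have := hcon (u (n + 1)) (u n) (hwm.trans (hum _)) (hwm.trans (hum _)) n ih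
      rwa [← hus n] at this ⊢
  obtain ⟨l, hl⟩ := hC u hcau
  have hlm : w ^ m ∣ l := by
    have := dvd_add (hl m) (hum m)
    simpa using this
  have hfix : Φ l = l := by
    rw [← sub_eq_zero]
    apply eq_zero_of_forall_pow_dvd hw
    intro n
    have h5 := hcon l (u n) (hwm.trans hlm) (hwm.trans (hum _)) n (hl n)
    rw [← hus n] at h5
    have h6 := dvd_sub ((pow_dvd_pow w (Nat.le_succ n)).trans h5) ((pow_dvd_pow w (Nat.le_succ n)).trans (hl (n + 1)))
    simpa using h6
  refine ⟨a + d * l, ?_, ?_⟩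
  · rw [hH, hr]
    simp only [Φ] at hfix
    linear_combination (- d ^ 2) * hfix
  · have : a - (a + d * l) = -(d * l) := by ring
    rw [this]
    exact (hlm.mul_left _).neg_right

/-- Norm equivalence lemma for `p`-th powers. -/
lemma pow_norm_aux {A : Type*} [CommRing A] [IsDomain A] [IsDiscreteValuationRing A]
    {w : A} (hw : Irreducible w) (hC : SeqComplete w) (p : ℕ) [Fact p.Prime] [CharP A p]
    {ι : Type*} [DecidableEq ι] (c : ι → A) (s : Finset ι)
    (hc : ∀ g : ι → A, ∑ i ∈ s, c i * g i ^ p = 0 → ∀ i ∈ s, g i = 0) :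
    ∃ C : ℕ, ∀ g : ι → A, ∀ m : ℕ, w ^ (p * m + C) ∣ ∑ i ∈ s, c i * g i ^ p →
      ∀ i ∈ s, w ^ m ∣ g i := by
  induction s using Finset.strongInduction with
  | H s ih =>
  have hp : p.Prime := Fact.out
  -- key: bounded for normalised vectors
  have key : ∀ i ∈ s, ∃ C : ℕ, ∀ g : ι → A, g i = 1 → ¬ w ^ C ∣ ∑ j ∈ s, c j * g j ^ p := by
    intro i hi
    by_contra hcon
    push Not at hcon
    obtain ⟨C, hCs⟩ := ih (s.erase i) (Finset.erase_ssubset hi) (by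
      intro g hg j hj
      have := hc (Function.update g i 0) (by
        rw [← Finset.add_sum_erase _ _ hi]
        simp only [Function.update_self, zero_pow hp.ne_zero, mul_zero, zero_add]
        rw [← hg]
        refine Finset.sum_congr rfl fun k hk => ?_
        rw [Function.update_of_ne (Finset.ne_of_mem_erase hk)]) j (Finset.mem_of_mem_erase hj)
      rwa [Function.update_of_ne (Finset.ne_of_mem_erase hj)] at this)
    choose G hG1 hG2 using fun n : ℕ => hcon (p * n + C)
    have hcau : ∀ j ∈ s.erase i, ∀ n, w ^ n ∣ G (n + 1) j - G n j := by
      intro j hj n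
      refine hCs (fun j => G (n + 1) j - G n j) n ?_ j hj
      have e : ∑ j ∈ s.erase i, c j * (G (n + 1) j - G n j) ^ p =
          ∑ j ∈ s, c j * G (n + 1) j ^ p - ∑ j ∈ s, c j * G n j ^ p := by
        rw [← Finset.sum_sub_distrib, ← Finset.add_sum_erase _ _ hi, hG1, hG1]
        simp only [sub_self, zero_add]
        refine Finset.sum_congr rfl fun k hk => ?_
        rw [sub_pow_char, mul_sub]
      rw [e]
      refine dvd_sub ((pow_dvd_pow w ?_).trans (hG2 (n + 1))) (hG2 n)
      nlinarith
    have : ∀ j, ∃ l, j ∈ s.erase i → ∀ n, w ^ n ∣ l - G n j := by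
      intro j
      by_cases hj : j ∈ s.erase i
      · obtain ⟨l, hl⟩ := hC (fun n => G n j) (hcau j hj)
        exact ⟨l, fun _ => hl⟩
      · exact ⟨0, fun h => absurd h hj⟩
    choose l hl using this
    have hzero := hc (Function.update l i 1) (by
      apply eq_zero_of_forall_pow_dvd hw
      intro n
      have e : ∑ j ∈ s, c j * (Function.update l i 1) j ^ p =
          ∑ j ∈ s.erase i, c j * (l j - G n j) ^ p + ∑ j ∈ s, c j * G n j ^ p := by
        rw [← Finset.add_sum_erase _ _ hi, ← Finset.add_sum_erase (a := i) s _ hi, hG1,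
          Function.update_self, add_left_comm, ← Finset.sum_add_distrib]
        congr 1
        refine Finset.sum_congr rfl fun k hk => ?_
        rw [Function.update_of_ne (Finset.ne_of_mem_erase hk), sub_pow_char]
        ring
      rw [e]
      refine dvd_add (Finset.dvd_sum fun j hj => ?_) ?_
      · exact ((hl j hj n).trans (dvd_pow_self _ hp.ne_zero)).mul_left _
      · refine (pow_dvd_pow w ?_).trans (hG2 n)
        nlinarith [hp.one_lt]) i hi
    simp at hzero
  choose! C hCC using key
  refine ⟨∑ i ∈ s, C i, fun g => ?_⟩
  -- induct on m
  intro m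
  induction m generalizing g with
  | zero => intro _ i _; simp
  | succ m ihm =>
    intro hdiv i hi
    have hall : ∀ j ∈ s, w ∣ g j := by
      intro j hj
      by_contra hnd
      have hun : IsUnit (g j) := by
        by_contra hnu
        exact hnd (((IsDiscreteValuationRing.irreducible_iff_uniformizer w).1 hw ▸
          (IsLocalRing.mem_maximalIdeal _).2 hnu : g j ∈ Ideal.span {w}) |> Ideal.mem_span_singleton.1)
      obtain ⟨v, hv⟩ := hun
      apply hCC j hj (fun k => (v⁻¹ : Aˣ) * g k) (by simp [← hv])
      have e : ∑ k ∈ s, c k * ((v⁻¹ : Aˣ) * g k) ^ p = ((v⁻¹ : Aˣ) : A) ^ p * ∑ k ∈ s, c k * g k ^ p := by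
        rw [Finset.mul_sum]; refine Finset.sum_congr rfl fun k _ => by ring
      rw [e]
      refine ((pow_dvd_pow w ?_).trans hdiv).mul_left _
      have := Finset.single_le_sum (f := C) (fun _ _ => Nat.zero_le _) hj
      omega
    choose! g' hg' using hall
    have e : ∑ k ∈ s, c k * g k ^ p = w ^ p * ∑ k ∈ s, c k * g' k ^ p := by
      rw [Finset.mul_sum]; refine Finset.sum_congr rfl fun k hk => by rw [hg' k hk]; ring
    rw [e, show p * (m + 1) + ∑ i ∈ s, C i = p + (p * m + ∑ i ∈ s, C i) by ring, pow_add,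
      mul_dvd_mul_iff_left (pow_ne_zero _ hw.ne_zero)] at hdiv
    rw [hg' i hi, pow_succ, mul_comm]
    exact mul_dvd_mul_left _ (ihm g' hdiv i hi)

open scoped TensorProduct in
lemma formallySmooth_crit {F L : Type*} [Field F] [Field L] [Algebra F L] :
    Algebra.FormallySmooth F L ↔ ∀ f : MvPolynomial L F, aeval (id : L → L) f = 0 →
      (∀ i, aeval (id : L → L) (pderiv i f) = 0) →
      f ∈ (RingHom.ker (aeval (R := F) (id : L → L))) ^ 2 := by
  let : Algebra (MvPolynomial L F) L := (aeval (R := F) (id : L → L)).toAlgebra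
  have : IsScalarTower F (MvPolynomial L F) L := IsScalarTower.of_algebraMap_eq' (by
    ext x; change _ = aeval (R := F) (id : L → L) _; simp)
  have hmap : ∀ x, algebraMap (MvPolynomial L F) L x = aeval (R := F) (id : L → L) x := fun _ => rfl
  have hsurj : Function.Surjective (algebraMap (MvPolynomial L F) L) := fun x => ⟨X x, by simp [hmap]⟩
  have h1 : Algebra.FormallySmooth F L ↔ Subsingleton (Algebra.H1Cotangent F L) := by
    rw [Algebra.formallySmooth_iff]
    exact ⟨fun h => h.2, fun h => ⟨inferInstance, h⟩⟩
  rw [h1, ← Algebra.FormallySmooth.kerCotangentToTensor_injective_iff hsurj]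
  have key : ∀ f : MvPolynomial L F, (∀ i, aeval (R := F) (id : L → L) (pderiv i f) = 0) ↔
      (1 : L) ⊗ₜ[MvPolynomial L F] (KaehlerDifferential.D F (MvPolynomial L F) f) = 0 := by
    intro f
    let b := (KaehlerDifferential.mvPolynomialBasis F L).baseChange (R := MvPolynomial L F) L
    have hb : ∀ i, b.repr ((1 : L) ⊗ₜ[MvPolynomial L F] (KaehlerDifferential.D F (MvPolynomial L F) f)) i =
        aeval (R := F) (id : L → L) (pderiv i f) := by
      intro i
      simp only [b, Module.Basis.baseChange_repr_tmul, KaehlerDifferential.mvPolynomialBasis_repr_apply,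
        Algebra.smul_def, mul_one, hmap]
    rw [b.ext_elem_iff]
    simp [hb]
  rw [injective_iff_map_eq_zero]
  constructor
  · intro h f hf hfi
    have := h (Ideal.toCotangent _ ⟨f, hf⟩) (by
      rw [KaehlerDifferential.kerCotangentToTensor_toCotangent]
      exact (key f).1 hfi)
    rw [Ideal.toCotangent_eq_zero] at this
    exact this
  · intro h z hz
    obtain ⟨⟨f, hf⟩, rfl⟩ := Ideal.toCotangent_surjective _ z
    rw [KaehlerDifferential.kerCotangentToTensor_toCotangent] at hz
    rw [Ideal.toCotangent_eq_zero]
    exact h f hf ((key f).2 hz)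

lemma formallySmooth_of_perfect {F L : Type*} [Field F] [Field L] [Algebra F L] [PerfectField F] :
    Algebra.FormallySmooth F L := by
  rw [formallySmooth_crit]
  intro f hf hfi
  let E : IntermediateField F L := IntermediateField.adjoin F (f.vars : Set L)
  have : Algebra.EssFiniteType F E :=
    IntermediateField.essFiniteType_iff.2 (IntermediateField.fg_adjoin_finset _)
  have hE := formallySmooth_crit.1 (inferInstance : Algebra.FormallySmooth F E)
  obtain ⟨f', hf'⟩ : ∃ f' : MvPolynomial E F, rename (fun x : E => (x : L)) f' = f := by
    have : (f.vars : Set L) ⊆ Set.range (fun x : E => (x : L)) := by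
      intro x hx
      exact ⟨⟨x, IntermediateField.subset_adjoin _ _ hx⟩, rfl⟩
    exact exists_rename_eq_of_vars_subset_range f _ Subtype.val_injective this
  have hcomm : ∀ q : MvPolynomial E F, aeval (id : L → L) (rename (fun x : E => (x : L)) q) =
      ((aeval (id : E → E) q : E) : L) := by
    intro q
    rw [aeval_rename]
    have := (MvPolynomial.aeval_algebraMap_apply L (id : E → E) q)
    rw [show (algebraMap E L) (aeval (id : E → E) q) = ((aeval (id : E → E) q : E) : L) from rfl] at this
    rw [← this]; rfl
  have := hE f' (by
    apply Subtype.val_injective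
    have := hcomm f'
    rw [hf', hf] at this
    exact this.symm) (by
    intro i
    apply Subtype.val_injective
    have := hcomm (pderiv i f')
    rw [← pderiv_rename Subtype.val_injective, hf', hfi] at this
    exact this.symm)
  have h2 := Ideal.mem_map_of_mem (rename (R := F) (fun x : E => (x : L))) this
  rw [hf', Ideal.map_pow] at h2
  refine Ideal.pow_right_mono ?_ 2 h2
  rw [Ideal.map_le_iff_le_comap]
  intro q hq
  rw [Ideal.mem_comap, RingHom.mem_ker, hcomm]
  rw [RingHom.mem_ker] at hq
  rw [hq]; rfl

/-- existence of a coefficient field -/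
lemma exists_coeff_field {F R : Type*} [Field F] [PerfectField F] [CommRing R] [IsLocalRing R]
    [IsAdicComplete (maximalIdeal R) R] [Algebra F R] :
    ∃ g : ResidueField R →+* R, ∀ x, residue R (g x) = x := by
  have := formallySmooth_of_perfect (F := F) (L := ResidueField R)
  obtain ⟨g, hg⟩ := Algebra.FormallySmooth.exists_mkₐ_comp_eq_of_isAdicComplete (R := F)
    (I := maximalIdeal R) (AlgHom.id F (ResidueField R))
  exact ⟨g.toRingHom, fun x => DFunLike.congr_fun hg x⟩

lemma exists_coeff_field' {K R : Type*} [Field K] [CommRing R] [IsLocalRing R]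
    [IsAdicComplete (maximalIdeal R) R] [Algebra K R] :
    ∃ g : ResidueField R →+* R, ∀ x, residue R (g x) = x := by
  obtain _ | ⟨p, hp, hpk⟩ := CharP.exists' K
  · let : Algebra ℚ R := ((algebraMap K R).comp (algebraMap ℚ K)).toAlgebra
    exact exists_coeff_field (F := ℚ)
  · let := ZMod.algebra K p
    let : Algebra (ZMod p) R := ((algebraMap K R).comp (algebraMap (ZMod p) K)).toAlgebra
    exact exists_coeff_field (F := ZMod p)

lemma exists_transcendence_sub {k L ι : Type*} [Field k] [Field L] [Algebra k L] (x : ι → L)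
    (hx : IntermediateField.adjoin k (Set.range x) = ⊤) :
    ∃ s : Set ι, IsTranscendenceBasis k (fun i : s => x i) := by
  have : Algebra.IsAlgebraic (Algebra.adjoin k (Set.range x)) L := by
    rw [← IntermediateField.isAlgebraic_adjoin_iff_top, hx, Algebra.isAlgebraic_iff_isIntegral]
    exact Algebra.isIntegral_of_surjective IntermediateField.topEquiv.surjective
  obtain ⟨t, hts, ht⟩ := exists_isTranscendenceBasis_subset (R := k) (Set.range x)
  choose r hrr using fun y : t => hts y.2
  have hinj : Function.Injective r := by
    intro a b hab
    apply Subtype.ext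
    rw [← hrr a, ← hrr b, hab]
  refine ⟨Set.range r, ?_⟩
  let e : t ≃ Set.range r := Equiv.ofInjective r hinj
  have h2 := ht.comp_equiv e.symm
  convert h2 using 1
  ext i
  obtain ⟨y, rfl⟩ := e.surjective i
  simp [e, hrr]

lemma sep_dichotomy {k L ι : Type*} [Field k] [Field L] [Algebra k L] [Finite ι] (x : ι → L)
    (hx : IntermediateField.adjoin k (Set.range x) = ⊤) :
    (∃ s : Set ι, AlgebraicIndependent k (fun i : s => x i) ∧
      ∀ j, IsSeparable (IntermediateField.adjoin k (x '' s)) (x j)) ∨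
    (∃ p : ℕ, p.Prime ∧ CharP k p ∧ ∃ s : Finset L, LinearIndepOn k id (s : Set L) ∧
      ¬ LinearIndepOn k (· ^ p) (s : Set L)) := by
  obtain ⟨s₀, hs₀⟩ := exists_transcendence_sub x hx
  obtain h0 | ⟨p, hp, hpk⟩ := CharP.exists' k
  · left
    refine ⟨s₀, hs₀.1, fun j => ?_⟩
    have h1 := hs₀.isAlgebraic_field
    rw [show Set.range (fun i : s₀ => x i) = x '' s₀ by rw [Set.image_eq_range]] at h1
    have : CharZero (IntermediateField.adjoin k (x '' s₀)) :=
      charZero_of_injective_algebraMap (algebraMap k _).injective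
    exact Algebra.IsSeparable.isSeparable _ (x j)
  · by_cases H : ∀ s : Finset L, LinearIndepOn k id (s : Set L) → LinearIndepOn k (· ^ p) (s : Set L)
    · left
      have : ExpChar k p := .prime hp.out
      obtain ⟨s, hs, hmax⟩ := Set.exists_max_image {s : Set ι | IsTranscendenceBasis k (fun i : s => x i)}
        (fun s => Set.ncard {j | IsSeparable (IntermediateField.adjoin k (x '' s)) (x j)})
        (Set.toFinite _) ⟨s₀, hs₀⟩
      refine ⟨s, hs.1, fun n => ?_⟩
      by_contra hn
      have hns : n ∉ s := fun h => hn
        (isSeparable_algebraMap (F := IntermediateField.adjoin k (x '' s))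
          ⟨x n, IntermediateField.subset_adjoin _ _ ⟨n, h, rfl⟩⟩)
      obtain ⟨i, hi1, hi2⟩ := exists_isTranscendenceBasis_and_isSeparable_of_linearIndepOn_pow'
        p hp.out H s n hs hns
      set s' := insert n s \ {i} with hs'
      have hmem : ∀ j ∈ insert n s, IsSeparable (IntermediateField.adjoin k (x '' s')) (x j) := by
        intro j hj
        obtain rfl | ne := eq_or_ne j i
        · exact hi2
        · exact (isSeparable_algebraMap (F := IntermediateField.adjoin k (x '' s'))
            ⟨x j, IntermediateField.subset_adjoin _ _ ⟨j, ⟨hj, ne⟩, rfl⟩⟩)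
      have hle : (separableClosure (IntermediateField.adjoin k (x '' s)) L).restrictScalars k ≤
          (separableClosure (IntermediateField.adjoin k (x '' s')) L).restrictScalars k := by
        rw [separableClosure_le_separableClosure_iff, IntermediateField.adjoin_le_iff]
        rintro _ ⟨j, hj, rfl⟩
        exact hmem j (Or.inr hj)
      have hlt := hmax s' hi1
      refine absurd hlt (not_le.2 (Set.ncard_lt_ncard ?_ (Set.toFinite _)))
      rw [Set.ssubset_iff_of_subset]
      · exact ⟨n, hmem n (Or.inl rfl), hn⟩
      · intro j hj
        exact hle hj
    · right
      push Not at H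
      exact ⟨p, hp.out, hpk, H⟩

lemma exists_poly_of_sep {A k L σ : Type*} [CommRing A] [IsDomain A] [Field k] [Algebra A k]
    [IsFractionRing A k] [Field L] [Algebra A L] [Algebra k L] [IsScalarTower A k L]
    (x : σ → L) (s : Set σ)
    (hind : Function.Injective (aeval (R := A) (fun i : s => x i))) (y : L)
    (hy : IsSeparable (IntermediateField.adjoin k (x '' s)) y) :
    ∃ F : Polynomial (MvPolynomial s A),
      F.eval₂ (aeval (R := A) (fun i : s => x i)).toRingHom y = 0 ∧
      F.derivative.eval₂ (aeval (R := A) (fun i : s => x i)).toRingHom y ≠ 0 := by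
  set φ : MvPolynomial s A →+* L := (aeval (R := A) (fun i : s => x i)).toRingHom with hφ
  have hφi : Function.Injective φ := hind
  let Q := FractionRing (MvPolynomial s A)
  let ψ : Q →+* L := IsFractionRing.lift hφi
  have hψ : ∀ m, ψ (algebraMap _ Q m) = φ m := fun m => IsFractionRing.lift_algebraMap hφi m
  have hk : ∀ a : k, algebraMap k L a ∈ ψ.fieldRange := by
    intro a
    obtain ⟨b, c, hc, rfl⟩ := IsFractionRing.div_surjective (A := A) a
    rw [map_div₀]
    have : ∀ b : A, algebraMap k L (algebraMap A k b) ∈ ψ.fieldRange := fun b =>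
      ⟨algebraMap _ Q (C b), by
        rw [hψ, ← IsScalarTower.algebraMap_apply]; simp [hφ]⟩
    exact div_mem (this b) (this c)
  let E' : IntermediateField k L := { ψ.fieldRange with
    algebraMap_mem' := hk
    inv_mem' := fun a ha => inv_mem (S := Subfield L) (s := ψ.fieldRange) ha }
  have hE : IntermediateField.adjoin k (x '' s) ≤ E' := by
    rw [IntermediateField.adjoin_le_iff]
    rintro _ ⟨j, hj, rfl⟩
    exact ⟨algebraMap (MvPolynomial s A) Q (X (⟨j, hj⟩ : s)), by rw [hψ]; simp [hφ]⟩
  let p := minpoly (IntermediateField.adjoin k (x '' s)) y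
  have hp : p.Separable := hy
  have hpy : Polynomial.aeval y p = 0 := minpoly.aeval _ _
  choose r hr using fun z : IntermediateField.adjoin k (x '' s) => (hE z.2 : (z : L) ∈ ψ.fieldRange)
  let ι : IntermediateField.adjoin k (x '' s) →+* Q :=
    { toFun := r
      map_one' := ψ.injective (by rw [hr]; simp)
      map_zero' := ψ.injective (by rw [hr]; simp)
      map_mul' := fun a b => ψ.injective (by rw [map_mul, hr, hr, hr]; simp)
      map_add' := fun a b => ψ.injective (by rw [map_add, hr, hr, hr]; simp) }
  have hι : ψ.comp ι = algebraMap _ L := by ext z; exact hr z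
  let p' : Polynomial Q := p.map ι
  have hp' : p'.Separable := hp.map
  have hpy' : p'.eval₂ ψ y = 0 := by
    rw [Polynomial.eval₂_map, hι]; exact hpy
  have hdy' : p'.derivative.eval₂ ψ y ≠ 0 := by
    intro h
    obtain ⟨a, b, hab⟩ := hp'
    have := congrArg (Polynomial.eval₂ ψ y) hab
    rw [Polynomial.eval₂_add, Polynomial.eval₂_mul, Polynomial.eval₂_mul, hpy', h] at this
    simp at this
  obtain ⟨d, hd⟩ := IsLocalization.integerNormalization_map_to_map
    (nonZeroDivisors (MvPolynomial s A)) p'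
  set F := IsLocalization.integerNormalization (nonZeroDivisors (MvPolynomial s A)) p' with hF
  have hψc : ψ.comp (algebraMap (MvPolynomial s A) Q) = φ := RingHom.ext hψ
  have hd2 : F.map (algebraMap _ Q) = Polynomial.C (algebraMap _ Q (d : MvPolynomial s A)) * p' := by
    rw [hd, Algebra.smul_def]; rfl
  refine ⟨F, ?_, ?_⟩
  · rw [← hψc, ← Polynomial.eval₂_map, hd2, Polynomial.eval₂_mul, hpy', mul_zero]
  · rw [← hψc, ← Polynomial.eval₂_map, ← Polynomial.derivative_map, hd2,
      Polynomial.derivative_C_mul, Polynomial.eval₂_mul, Polynomial.eval₂_C, hψ]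
    refine mul_ne_zero ?_ hdy'
    rw [Ne, map_eq_zero_iff _ hφi]
    exact nonZeroDivisors.ne_zero d.2

lemma sep_prime_le {A σ : Type*} [CommRing A] [IsDomain A] (P Q : Ideal (MvPolynomial σ A))
    [Q.IsPrime] (hQP : Q ≤ P) (s : Set σ)
    (hs : ∀ c : MvPolynomial s A, rename Subtype.val c ∈ P → c = 0)
    (F : σ → Polynomial (MvPolynomial s A)) (hF0 : ∀ j ∉ s, F j ≠ 0)
    (hF : ∀ j ∉ s, (F j).eval₂ (rename (R := A) (Subtype.val : s → σ)).toRingHom (X j) ∈ Q) :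
    P ≤ Q := by
  let S := MvPolynomial σ A ⧸ Q
  let f : MvPolynomial s A →+* S := (Ideal.Quotient.mk Q).comp (rename (R := A) (Subtype.val : s → σ)).toRingHom
  let : Algebra (MvPolynomial s A) S := f.toAlgebra
  have hX : ∀ j, IsAlgebraic (MvPolynomial s A) (Ideal.Quotient.mk Q (X j) : S) := by
    intro j
    by_cases hj : j ∈ s
    · have : (Ideal.Quotient.mk Q (X j) : S) = algebraMap (MvPolynomial s A) S (X ⟨j, hj⟩) := by
        change _ = Ideal.Quotient.mk Q (rename _ _)
        rw [rename_X]
      rw [this]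
      exact isAlgebraic_algebraMap _
    · refine ⟨F j, hF0 j hj, ?_⟩
      have := Ideal.Quotient.eq_zero_iff_mem.2 (hF j hj)
      rw [Polynomial.hom_eval₂] at this
      exact this
  have hall : ∀ q, IsAlgebraic (MvPolynomial s A) (Ideal.Quotient.mk Q q : S) := by
    intro q
    induction q using MvPolynomial.induction_on with
    | C a =>
      have : (Ideal.Quotient.mk Q (C a) : S) = algebraMap (MvPolynomial s A) S (C a) := by
        change _ = Ideal.Quotient.mk Q (rename _ _)
        rw [rename_C]
      rw [this]
      exact isAlgebraic_algebraMap _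
    | add p q hp hq => rw [map_add]; exact hp.add hq
    | mul_X p n hp => rw [map_mul]; exact hp.mul (hX n)
  intro q hq
  by_contra hqQ
  have h1 := Ideal.comap_ne_bot_of_algebraic_mem (I := P.map (Ideal.Quotient.mk Q))
    (x := (Ideal.Quotient.mk Q q : S)) (fun h => hqQ (Ideal.Quotient.eq_zero_iff_mem.1 h))
    (Ideal.mem_map_of_mem _ hq) (hall q)
  apply h1
  rw [eq_bot_iff]
  intro c hc
  apply hs
  have hc' : Ideal.Quotient.mk Q (rename Subtype.val c) ∈ P.map (Ideal.Quotient.mk Q) := hc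
  rw [← Ideal.mem_comap, Ideal.comap_map_of_surjective _ Ideal.Quotient.mk_surjective,
    ← RingHom.ker_eq_comap_bot, Ideal.mk_ker, sup_eq_left.2 hQP] at hc'
  exact hc'

lemma sep_exists_mul {A σ : Type*} [CommRing A] [IsDomain A] (P : Ideal (MvPolynomial σ A))
    [P.IsPrime] (s : Set σ)
    (hs : ∀ c : MvPolynomial s A, rename Subtype.val c ∈ P → c = 0)
    (F : σ → Polynomial (MvPolynomial s A)) (hF0 : ∀ j ∉ s, F j ≠ 0)
    (q : MvPolynomial σ A) (hq : q ∈ P) :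
    ∃ h, h ∉ P ∧ ∃ m : ℕ, h * q ^ m ∈
      Ideal.span ((fun j => (F j).eval₂ (rename (R := A) (Subtype.val : s → σ)).toRingHom (X j)) '' sᶜ) := by
  set J := Ideal.span ((fun j => (F j).eval₂ (rename (R := A) (Subtype.val : s → σ)).toRingHom (X j)) '' sᶜ)
  by_contra hcon
  push Not at hcon
  obtain ⟨Q, hQ, hJQ, hdis⟩ := Ideal.exists_le_prime_disjoint J (P.primeCompl ⊔ Submonoid.powers q) (by
    rw [Set.disjoint_left]
    intro z hz hz'
    obtain ⟨h, hh, _, ⟨m, rfl⟩, rfl⟩ := Submonoid.mem_sup.1 hz'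
    exact hcon h hh m hz)
  rw [Set.disjoint_left] at hdis
  have hQP : Q ≤ P := by
    intro z hz
    by_contra hzP
    exact hdis hz ((le_sup_left : P.primeCompl ≤ _) hzP)
  have := sep_prime_le P Q hQP s hs F hF0 (fun j hj => hJQ (Ideal.subset_span ⟨j, hj, rfl⟩))
  exact hdis (this hq) ((le_sup_right : Submonoid.powers q ≤ _) (Submonoid.mem_powers q))

def Good {A σ : Type*} [CommRing A] (w : A) (I : Ideal (MvPolynomial σ A)) : Prop :=
  ∃ c e : ℕ, ∀ (n : ℕ) (a : σ → A), (∀ q ∈ I, w ^ (c * n + e) ∣ eval a q) →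
    ∃ b : σ → A, (∀ q ∈ I, eval b q = 0) ∧ ∀ j, w ^ n ∣ a j - b j

lemma eval_sub_dvd {A σ : Type*} [CommRing A] (d : A) (a b : σ → A) (h : ∀ j, d ∣ a j - b j)
    (q : MvPolynomial σ A) : d ∣ eval a q - eval b q := by
  induction q using MvPolynomial.induction_on with
  | C r => simp
  | add p q hp hq =>
    rw [map_add, map_add, add_sub_add_comm]
    exact dvd_add hp hq
  | mul_X p n hp =>
    have : eval a (p * X n) - eval b (p * X n) =
      (eval a p - eval b p) * a n + eval b p * (a n - b n) := by
      simp; ring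
    rw [this]
    exact dvd_add (hp.mul_right _) ((h n).mul_left _)

lemma dvd_eval_sup {A σ : Type*} [CommRing A] (d : A) (a : σ → A) (P : Ideal (MvPolynomial σ A))
    (D : MvPolynomial σ A) (hP : ∀ q ∈ P, d ∣ eval a q) (hD : d ∣ eval a D) :
    ∀ q ∈ P ⊔ Ideal.span {D}, d ∣ eval a q := by
  have : P ⊔ Ideal.span {D} ≤ (Ideal.span {d}).comap (eval a) := by
    rw [sup_le_iff, Ideal.span_singleton_le_iff_mem]
    refine ⟨fun q hq => ?_, ?_⟩
    · exact Ideal.mem_span_singleton.2 (hP q hq)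
    · exact Ideal.mem_span_singleton.2 hD
  exact fun q hq => Ideal.mem_span_singleton.1 (this hq)

lemma good_sep {A σ : Type*} [CommRing A] [IsDomain A] [IsDiscreteValuationRing A] [Finite σ]
    {w : A} (hw : Irreducible w) (hC : SeqComplete w) (P : Ideal (MvPolynomial σ A)) [P.IsPrime]
    (s : Set σ) (hs : ∀ c : MvPolynomial s A, rename Subtype.val c ∈ P → c = 0)
    (F : σ → Polynomial (MvPolynomial s A))
    (hF : ∀ j ∉ s, (F j).eval₂ (rename (R := A) (Subtype.val : s → σ)).toRingHom (X j) ∈ P)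
    (hD : ∀ j ∉ s, (F j).derivative.eval₂ (rename (R := A) (Subtype.val : s → σ)).toRingHom (X j) ∉ P)
    (IH : ∀ D ∉ P, Good w (P ⊔ Ideal.span {D})) : Good w P := by
  classical
  have := Fintype.ofFinite σ
  have hF0 : ∀ j ∉ s, F j ≠ 0 := by
    intro j hj h
    apply hD j hj
    rw [h]; simp
  obtain ⟨G, hG⟩ := IsNoetherian.noetherian P
  have hGP : ∀ q ∈ G, q ∈ P := fun q hq => hG ▸ Ideal.subset_span hq
  choose! h hh m hm using fun q (hq : q ∈ P) => sep_exists_mul P s hs F hF0 q hq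
  set Φ : σ → MvPolynomial σ A := fun j =>
    (F j).eval₂ (rename (R := A) (Subtype.val : s → σ)).toRingHom (X j) with hΦ
  set Δ : σ → MvPolynomial σ A := fun j =>
    (F j).derivative.eval₂ (rename (R := A) (Subtype.val : s → σ)).toRingHom (X j) with hΔ
  set D := (∏ j ∈ Finset.univ.filter (· ∉ s), Δ j) * ∏ q ∈ G, h q with hDdef
  have hDP : D ∉ P := by
    intro hD'
    rcases Ideal.IsPrime.mem_or_mem ‹_› hD' with h1 | h1
    · obtain ⟨j, hj, h2⟩ := (Ideal.IsPrime.prod_mem_iff).1 h1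
      exact hD j (Finset.mem_filter.1 hj).2 h2
    · obtain ⟨j, hj, h2⟩ := (Ideal.IsPrime.prod_mem_iff).1 h1
      exact hh j (hGP j hj) h2
  have hev : ∀ (F : Polynomial (MvPolynomial s A)) (a : σ → A) (j : σ),
      eval a (F.eval₂ (rename (R := A) (Subtype.val : s → σ)).toRingHom (X j)) =
      (F.map (eval (fun i : s => a i))).eval (a j) := by
    intro F a j
    rw [Polynomial.hom_eval₂, Polynomial.eval_map, eval_X]
    congr 1
    ext i <;> simp
  obtain ⟨c, e, hce⟩ := IH D hDP
  refine ⟨3 * c + 1, 3 * e + 1, fun n a ha => ?_⟩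
  obtain ⟨E, hE⟩ : ∃ E, E = c * n + e := ⟨_, rfl⟩
  have hν : (3 * c + 1) * n + (3 * e + 1) = 2 * E + (E + n + 1) := by rw [hE]; ring
  rw [hν] at ha
  by_cases hDa : w ^ E ∣ eval a D
  · obtain ⟨b, hb, hab⟩ := hce n a (by
      rw [← hE]
      exact dvd_eval_sup _ a P D (fun q hq => (pow_dvd_pow w (by omega)).trans (ha q hq)) hDa)
    exact ⟨b, fun q hq => hb q (Ideal.mem_sup_left hq), hab⟩
  · have hΔa : ∀ j ∉ s, ¬ w ^ E ∣ eval a (Δ j) := by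
      intro j hj hd
      apply hDa
      rw [hDdef, map_mul, map_prod]
      exact (hd.trans (Finset.dvd_prod_of_mem (fun j => eval a (Δ j)) (by simpa using hj))).mul_right _
    have hha : ∀ q ∈ G, ¬ w ^ E ∣ eval a (h q) := by
      intro j hj hd
      apply hDa
      rw [hDdef, map_mul, map_prod, map_prod]
      exact (hd.trans (Finset.dvd_prod_of_mem (fun j => eval a (h j)) hj)).mul_left _
    have key : ∀ j, ∃ bj, (j ∈ s → bj = a j) ∧ (j ∉ s → ((F j).map (eval (fun i : s => a i))).eval bj = 0) ∧
        w ^ (E + n + 1) ∣ a j - bj := by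
      intro j
      by_cases hj : j ∈ s
      · exact ⟨a j, fun _ => rfl, fun h => absurd hj h, by simp⟩
      · obtain ⟨b, hb1, hb2⟩ := hensel_quant hw hC ((F j).map (eval (fun i : s => a i))) (a j) E
          (E + n + 1) (by omega) (by
            rw [← hev]; exact ha _ (hF j hj)) (by
            rw [Polynomial.derivative_map, ← hev]; exact hΔa j hj)
        exact ⟨b, fun h => absurd h hj, fun _ => hb1, hb2⟩
    choose b hb1 hb2 hb3 using key
    have hbs : (fun i : s => b i) = fun i : s => a i := funext fun i => hb1 i i.2
    refine ⟨b, ?_, fun j => (pow_dvd_pow w (by omega)).trans (hb3 j)⟩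
    have hΦb : Ideal.span (Φ '' sᶜ) ≤ RingHom.ker (eval b) := by
      rw [Ideal.span_le]
      rintro _ ⟨j, hj, rfl⟩
      change eval b (Φ j) = 0
      rw [hΦ]
      change eval b ((F j).eval₂ _ _) = 0
      rw [hev, hbs]
      exact hb2 j hj
    have hGb : P ≤ RingHom.ker (eval b) := by
      rw [← hG, Ideal.span_le]
      intro q hq
      have h1 : eval b (h q * q ^ m q) = 0 := hΦb (hm q (hGP q hq))
      rw [map_mul, map_pow] at h1
      rcases mul_eq_zero.1 h1 with h2 | h2
      · exfalso
        apply hha q hq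
        have h3 := eval_sub_dvd (w ^ (E + n + 1)) a b hb3 (h q)
        rw [h2, sub_zero] at h3
        exact (pow_dvd_pow w (by omega)).trans h3
      · exact eq_zero_of_pow_eq_zero h2
    exact fun q hq => hGb hq

lemma good_insep {A σ ι : Type*} [CommRing A] [IsDomain A] [IsDiscreteValuationRing A]
    [DecidableEq ι]
    {w : A} (hw : Irreducible w) (hC : SeqComplete w) (P : Ideal (MvPolynomial σ A))
    (p : ℕ) [Fact p.Prime] [CharP A p] (c : ι → A) (s : Finset ι)
    (hc : ∀ g : ι → A, ∑ i ∈ s, c i * g i ^ p = 0 → ∀ i ∈ s, g i = 0)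
    (G : ι → MvPolynomial σ A) (hG : ∑ i ∈ s, C (c i) * G i ^ p ∈ P) (i₀ : ι) (hi₀ : i₀ ∈ s)
    (hGi : G i₀ ∉ P)
    (IH : ∀ D ∉ P, Good w (P ⊔ Ideal.span {D})) : Good w P := by
  obtain ⟨C₀, hC₀⟩ := pow_norm_aux hw hC p c s hc
  obtain ⟨c', e, hce⟩ := IH _ hGi
  refine ⟨p * c' + c', p * e + C₀ + e, fun n a ha => ?_⟩
  have hν : (p * c' + c') * n + (p * e + C₀ + e) = p * (c' * n + e) + C₀ + (c' * n + e) := by ring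
  rw [hν] at ha
  have h1 := ha _ hG
  simp only [map_sum, map_mul, map_pow, eval_C] at h1
  have h2 := hC₀ (fun i => eval a (G i)) (c' * n + e) ((pow_dvd_pow w (by omega)).trans h1) i₀ hi₀
  obtain ⟨b, hb, hab⟩ := hce n a
    (dvd_eval_sup _ a P _ (fun q hq => (pow_dvd_pow w (by omega)).trans (ha q hq)) h2)
  exact ⟨b, fun q hq => hb q (Ideal.mem_sup_left hq), hab⟩

lemma insep_min {K L ι : Type*} [Field K] [Field L] [Algebra K L] [DecidableEq ι] (p : ℕ)
    [Fact p.Prime] [CharP K p] (c : ι → K) (s : Finset ι) : ∀ (v : ι → L)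
    (_ : ∀ g : ι → K, ∑ i ∈ s, algebraMap K L (g i) * v i = 0 → ∀ i ∈ s, g i = 0)
    (_ : ∃ i ∈ s, c i ≠ 0) (_ : ∑ i ∈ s, algebraMap K L (c i) * v i ^ p = 0),
    ∃ (s' : Finset ι) (v' : ι → L),
      (∀ g : ι → K, ∑ i ∈ s', c i * g i ^ p = 0 → ∀ i ∈ s', g i = 0) ∧
      ∑ i ∈ s', algebraMap K L (c i) * v' i ^ p = 0 ∧ ∃ i ∈ s', v' i ≠ 0 := by
  have hp : p ≠ 0 := (Fact.out : p.Prime).ne_zero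
  have : CharP L p := charP_of_injective_algebraMap (algebraMap K L).injective p
  induction s using Finset.strongInduction with
  | H s ih =>
    intro v hv hne hsum
    by_cases hind : ∀ g : ι → K, ∑ i ∈ s, c i * g i ^ p = 0 → ∀ i ∈ s, g i = 0
    · obtain ⟨i, hi, hci⟩ := hne
      refine ⟨s, v, hind, hsum, i, hi, fun hvi => ?_⟩
      have := hv (Pi.single i 1) (by
        apply Finset.sum_eq_zero
        intro j hj
        by_cases hji : j = i
        · subst hji; simp [hvi]
        · simp [Pi.single_eq_of_ne hji]) i hi
      simp at this
    · push Not at hind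
      obtain ⟨g, hg, i₀, hi₀, hgi⟩ := hind
      let h : ι → K := fun i => g i / g i₀
      have hh : c i₀ = - ∑ i ∈ s.erase i₀, c i * h i ^ p := by
        have h1 : ∑ i ∈ s, c i * h i ^ p = 0 := by
          have : ∑ i ∈ s, c i * h i ^ p = (∑ i ∈ s, c i * g i ^ p) / g i₀ ^ p := by
            rw [Finset.sum_div]
            refine Finset.sum_congr rfl fun i _ => ?_
            simp only [h, div_pow]; ring
          rw [this, hg, zero_div]
        rw [← Finset.add_sum_erase s _ hi₀] at h1
        have : h i₀ = 1 := div_self hgi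
        rw [this, one_pow, mul_one] at h1
        exact eq_neg_of_add_eq_zero_left h1
      refine ih (s.erase i₀) (Finset.erase_ssubset hi₀)
        (fun i => v i - algebraMap K L (h i) * v i₀) ?_ ?_ ?_
      · intro f hf i hi
        let f' : ι → K := fun i => if i = i₀ then - ∑ j ∈ s.erase i₀, f j * h j else f i
        have h1 : ∑ i ∈ s.erase i₀, algebraMap K L (f' i) * v i =
            ∑ i ∈ s.erase i₀, algebraMap K L (f i) * v i := by
          refine Finset.sum_congr rfl fun j hj => ?_
          simp [f', Finset.ne_of_mem_erase hj]
        have h2 := hv f' (by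
          rw [← Finset.add_sum_erase s _ hi₀, h1, ← hf]
          simp only [f', if_true, map_neg, map_sum, map_mul, mul_sub, Finset.sum_sub_distrib,
            neg_mul, Finset.sum_mul]
          rw [sub_eq_neg_add]
          congr 2
          exact Finset.sum_congr rfl fun _ _ => by ring) i (Finset.mem_of_mem_erase hi)
        simpa [f', Finset.ne_of_mem_erase hi] using h2
      · by_contra hcon
        push Not at hcon
        have hc0 : c i₀ = 0 := by
          rw [hh, Finset.sum_eq_zero, neg_zero]
          intro i hi
          rw [hcon i hi, zero_mul]
        obtain ⟨i, hi, hci⟩ := hne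
        by_cases hii : i = i₀
        · exact hci (hii ▸ hc0)
        · exact hci (hcon i (Finset.mem_erase.2 ⟨hii, hi⟩))
      · rw [← Finset.add_sum_erase s _ hi₀, hh] at hsum
        rw [← hsum]
        simp only [sub_pow_char, mul_sub, Finset.sum_sub_distrib, map_neg, map_sum, map_mul,
          map_pow, mul_pow, neg_mul, Finset.sum_mul]
        rw [sub_eq_neg_add]
        congr 2
        exact Finset.sum_congr rfl fun _ _ => by ring

lemma good_of_field {A K L σ : Type*} [CommRing A] [IsDomain A] [IsDiscreteValuationRing A]
    [Finite σ] [Field K] [Algebra A K] [IsFractionRing A K] [Field L] [Algebra A L] [Algebra K L]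
    [IsScalarTower A K L]
    {w : A} (hw : Irreducible w) (hC : SeqComplete w) (φ : MvPolynomial σ A →ₐ[A] L)
    (hφ : ∀ z : L, ∃ x y, φ y ≠ 0 ∧ z = φ x / φ y)
    (IH : ∀ D ∉ RingHom.ker φ, Good w (RingHom.ker φ ⊔ Ideal.span {D})) :
    Good w (RingHom.ker φ) := by
  classical
  have hAL : Function.Injective (algebraMap A L) := by
    rw [IsScalarTower.algebraMap_eq A K L]
    exact (algebraMap K L).injective.comp (IsFractionRing.injective A K)
  let x : σ → L := fun j => φ (X j)
  have hφx : φ = aeval x := by ext i; simp [x]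
  have hx : IntermediateField.adjoin K (Set.range x) = ⊤ := by
    rw [eq_top_iff]
    intro z _
    obtain ⟨a, b, hb, rfl⟩ := hφ z
    have : ∀ a, φ a ∈ IntermediateField.adjoin K (Set.range x) := by
      intro a
      induction a using MvPolynomial.induction_on with
      | C a =>
        rw [← MvPolynomial.algebraMap_eq, AlgHom.commutes, IsScalarTower.algebraMap_apply A K L]
        exact IntermediateField.algebraMap_mem _ _
      | add p q hp hq => rw [map_add]; exact add_mem hp hq
      | mul_X p n hp =>
        rw [map_mul]; exact mul_mem hp (IntermediateField.subset_adjoin _ _ ⟨n, rfl⟩)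
    exact div_mem (this a) (this b)
  rcases sep_dichotomy x hx with ⟨s, hs1, hs2⟩ | ⟨p, hp, hpK, s, hs1, hs2⟩
  · have hinj : Function.Injective (aeval (R := A) (fun i : s => x i)) := by
      have h1 : AlgebraicIndependent A (fun i : s => x i) :=
        hs1.restrictScalars (IsFractionRing.injective A K)
      exact h1
    choose F hF1 hF2 using fun j => exists_poly_of_sep (A := A) x s hinj (x j) (hs2 j)
    have hcomp : ∀ (F : Polynomial (MvPolynomial s A)) (j : σ),
        φ (F.eval₂ (rename (R := A) (Subtype.val : s → σ)).toRingHom (X j)) =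
        F.eval₂ (aeval (R := A) (fun i : s => x i)).toRingHom (x j) := by
      intro F j
      have := Polynomial.hom_eval₂ F (rename (R := A) (Subtype.val : s → σ)).toRingHom φ.toRingHom (X j)
      refine this.trans ?_
      congr 1
      ext i <;> simp [x]
    have : (RingHom.ker φ).IsPrime := RingHom.ker_isPrime φ
    refine good_sep hw hC (RingHom.ker φ) s ?_ F ?_ ?_ IH
    · intro c hc
      apply hinj
      rw [map_zero, ← hc, hφx, aeval_rename]
      rfl
    · intro j _
      rw [RingHom.mem_ker, hcomp, hF1]
    · intro j _
      rw [RingHom.mem_ker, hcomp]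
      exact hF2 j
  · have := Fact.mk hp
    have : CharP A p := (algebraMap A K).charP (IsFractionRing.injective A K) p
    rw [linearIndepOn_finset_iff] at hs1 hs2
    push Not at hs2
    obtain ⟨c, hc1, i₁, hi₁, hci⟩ := hs2
    obtain ⟨s', v, h1, h2, i₀, hi₀, hv⟩ := insep_min p c s id
      (fun g hg => hs1 g (by simpa [Algebra.smul_def] using hg)) ⟨i₁, hi₁, hci⟩
      (by simpa [Algebra.smul_def] using hc1)
    obtain ⟨d, hd⟩ := IsLocalization.exist_integer_multiples_of_finset (nonZeroDivisors A) (s'.image c)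
    have hd' : ∀ i : L, ∃ a : A, i ∈ s' → algebraMap A K a = algebraMap A K d * c i := by
      intro i
      by_cases hi : i ∈ s'
      · obtain ⟨a, ha⟩ := hd (c i) (Finset.mem_image_of_mem _ hi)
        exact ⟨a, fun _ => by rw [ha, Algebra.smul_def]⟩
      · exact ⟨0, fun h => absurd h hi⟩
    choose c' hc' using hd'
    choose x₁ y₁ hy₁ hxy using fun i => hφ (v i)
    let Y := ∏ j ∈ s', y₁ j
    have hY : φ Y ≠ 0 := by
      rw [map_prod]
      exact Finset.prod_ne_zero_iff.2 fun i _ => hy₁ i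
    let G : L → MvPolynomial σ A := fun i => x₁ i * ∏ j ∈ s'.erase i, y₁ j
    have hG : ∀ i ∈ s', φ (G i) = v i * φ Y := by
      intro i hi
      have h3 : φ Y = φ (y₁ i) * φ (∏ j ∈ s'.erase i, y₁ j) := by
        rw [← map_mul, Finset.mul_prod_erase s' y₁ hi]
      rw [h3, map_mul, hxy i]
      field_simp [hy₁ i]
    have hd0 : algebraMap A K d ≠ 0 := by
      rw [Ne, map_eq_zero_iff _ (IsFractionRing.injective A K)]
      exact nonZeroDivisors.ne_zero d.2
    refine good_insep hw hC (RingHom.ker φ) p c' s' ?_ G ?_ i₀ hi₀ ?_ IH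
    · intro g hg i hi
      have := h1 (fun i => algebraMap A K (g i)) (by
        apply mul_left_cancel₀ hd0
        rw [mul_zero, Finset.mul_sum, ← map_zero (algebraMap A K), ← hg, map_sum]
        refine Finset.sum_congr rfl fun j hj => ?_
        rw [map_mul, map_pow, hc' j hj, mul_assoc]) i hi
      exact IsFractionRing.injective A K (by rw [this, map_zero])
    · rw [RingHom.mem_ker, map_sum]
      have : ∀ i ∈ s', φ (C (c' i) * G i ^ p) =
          (algebraMap A L d * φ Y ^ p) * (algebraMap K L (c i) * v i ^ p) := by
        intro i hi
        rw [map_mul, map_pow, hG i hi, ← MvPolynomial.algebraMap_eq, AlgHom.commutes,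
          IsScalarTower.algebraMap_apply A K L, hc' i hi, map_mul,
          ← IsScalarTower.algebraMap_apply A K L]
        ring
      rw [Finset.sum_congr rfl this, ← Finset.mul_sum, h2, mul_zero]
    · rw [RingHom.mem_ker, hG i₀ hi₀]
      exact mul_ne_zero hv hY

theorem greenberg {A σ : Type*} [CommRing A] [IsDomain A] [IsDiscreteValuationRing A]
    [Finite σ] {w : A} (hw : Irreducible w) (hC : SeqComplete w)
    (I : Ideal (MvPolynomial σ A)) : Good w I := by
  induction I using WellFoundedGT.induction with
  | ind I IH =>
  by_cases htop : I = ⊤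
  · refine ⟨0, 1, fun n a ha => absurd (ha 1 (htop ▸ Submodule.mem_top)) ?_⟩
    simpa [← isUnit_iff_dvd_one] using hw.not_isUnit
  by_cases hP : I.IsPrime
  · by_cases hA : I.comap C = ⊥
    · let B := MvPolynomial σ A ⧸ I
      let L := FractionRing B
      let K := FractionRing A
      have hBL : Function.Injective (algebraMap B L) := IsFractionRing.injective B L
      have hAL : Function.Injective (algebraMap A L) := by
        rw [injective_iff_map_eq_zero]
        intro a ha
        rw [IsScalarTower.algebraMap_apply A B L, map_eq_zero_iff _ hBL] at ha
        have : Ideal.Quotient.mk I (C a) = 0 := ha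
        rw [Ideal.Quotient.eq_zero_iff_mem, ← Ideal.mem_comap, hA] at this
        exact this
      have : FaithfulSMul A L := (faithfulSMul_iff_algebraMap_injective A L).2 hAL
      let : Algebra K L := FractionRing.liftAlgebra A L
      have : IsScalarTower A K L := FractionRing.isScalarTower_liftAlgebra A L
      let φ : MvPolynomial σ A →ₐ[A] L := (IsScalarTower.toAlgHom A B L).comp (Ideal.Quotient.mkₐ A I)
      have hker : RingHom.ker φ = I := by
        ext q
        rw [RingHom.mem_ker]
        change algebraMap B L (Ideal.Quotient.mk I q) = 0 ↔ _
        rw [map_eq_zero_iff _ hBL, Ideal.Quotient.eq_zero_iff_mem]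
      have := good_of_field (K := K) hw hC φ (by
        intro z
        obtain ⟨a, b, hb, rfl⟩ := IsFractionRing.div_surjective (A := B) z
        obtain ⟨a, rfl⟩ := Ideal.Quotient.mk_surjective a
        obtain ⟨b, rfl⟩ := Ideal.Quotient.mk_surjective b
        refine ⟨a, b, ?_, rfl⟩
        change algebraMap B L (Ideal.Quotient.mk I b) ≠ 0
        rw [Ne, map_eq_zero_iff _ hBL]
        exact nonZeroDivisors.ne_zero hb) (by
        rw [hker]
        intro D hD
        apply IH
        rw [left_lt_sup, Ideal.span_singleton_le_iff_mem]
        exact hD)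
      rwa [hker] at this
    · obtain ⟨x, hx, hx0⟩ := Submodule.exists_mem_ne_zero_of_ne_bot hA
      obtain ⟨m, u, rfl⟩ := IsDiscreteValuationRing.eq_unit_mul_pow_irreducible hx0 hw
      refine ⟨0, m + 1, fun n a ha => absurd (ha _ hx) ?_⟩
      rw [eval_C, zero_mul, zero_add, Units.dvd_mul_left]
      rw [pow_dvd_pow_iff hw.ne_zero hw.not_isUnit]
      omega
  · rw [Ideal.isPrime_iff] at hP
    push Not at hP
    obtain ⟨x, y, hxy, hx, hy⟩ := hP htop
    obtain ⟨c₁, e₁, h₁⟩ := IH (I ⊔ Ideal.span {x}) (by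
      rw [left_lt_sup, Ideal.span_singleton_le_iff_mem]; exact hx)
    obtain ⟨c₂, e₂, h₂⟩ := IH (I ⊔ Ideal.span {y}) (by
      rw [left_lt_sup, Ideal.span_singleton_le_iff_mem]; exact hy)
    refine ⟨c₁ + c₂, e₁ + e₂, fun n a ha => ?_⟩
    have hν : (c₁ + c₂) * n + (e₁ + e₂) = (c₁ * n + e₁) + (c₂ * n + e₂) := by ring
    rw [hν] at ha
    have h3 := ha _ hxy
    rw [map_mul] at h3
    have hor : w ^ (c₁ * n + e₁) ∣ eval a x ∨ w ^ (c₂ * n + e₂) ∣ eval a y := by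
      have hwp : Prime w := hw.prime
      by_contra hcon
      push Not at hcon
      obtain ⟨q1, q2⟩ := hcon
      rw [pow_dvd_iff_le_emultiplicity] at q1 q2 h3
      rw [emultiplicity_mul hwp, Nat.cast_add] at h3
      rw [not_le] at q1 q2
      exact absurd h3 (not_le.2 (WithTop.add_lt_add q1 q2))
    rcases hor with h4 | h4
    · obtain ⟨b, hb, hab⟩ := h₁ n a
        (dvd_eval_sup _ a I _ (fun q hq => (pow_dvd_pow w (by omega)).trans (ha q hq)) h4)
      exact ⟨b, fun q hq => hb q (Ideal.mem_sup_left hq), hab⟩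
    · obtain ⟨b, hb, hab⟩ := h₂ n a
        (dvd_eval_sup _ a I _ (fun q hq => (pow_dvd_pow w (by omega)).trans (ha q hq)) h4)
      exact ⟨b, fun q hq => hb q (Ideal.mem_sup_left hq), hab⟩

lemma lift_poly {A S τ : Type*} [CommRing A] [CommRing S] [Algebra A S] {r : ℕ}
    (f : (Fin r → A) →ₗ[A] S) (hf : Function.Surjective f) (q : MvPolynomial τ S) :
    ∃ G : Fin r → MvPolynomial τ A, ∀ x : τ → A,
      f (fun k => eval x (G k)) = eval (fun i => algebraMap A S (x i)) q := by
  induction q using MvPolynomial.induction_on with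
  | C s =>
    obtain ⟨v, rfl⟩ := hf s
    exact ⟨fun k => C (v k), fun x => by simp⟩
  | add p q hp hq =>
    obtain ⟨G, hG⟩ := hp
    obtain ⟨H, hH⟩ := hq
    refine ⟨fun k => G k + H k, fun x => ?_⟩
    rw [map_add, ← hG, ← hH, ← map_add]
    congr 1
    ext k
    simp
  | mul_X p i hp =>
    obtain ⟨G, hG⟩ := hp
    refine ⟨fun k => G k * X i, fun x => ?_⟩
    rw [map_mul, ← hG, eval_X, mul_comm, ← Algebra.smul_def, ← map_smul]
    congr 1
    ext k
    simp [mul_comm]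

theorem transfer {A S σ : Type*} [CommRing A] [IsDomain A] [IsDiscreteValuationRing A]
    [Finite σ] {w : A} (hw : Irreducible w) (hC : SeqComplete w)
    [CommRing S] [Algebra A S] [Module.Finite A S] (g : MvPolynomial σ S) :
    ∃ c e : ℕ, ∀ (n : ℕ) (a : σ → S), algebraMap A S w ^ (c * n + e) ∣ eval a g →
      ∃ b : σ → S, eval b g = 0 ∧ ∀ j, algebraMap A S w ^ n ∣ a j - b j := by
  classical
  obtain ⟨r, f, hf⟩ := Module.Finite.exists_fin' A S
  obtain ⟨l, ρ, hρ⟩ := Submodule.fg_iff_exists_fin_generating_family.1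
    (IsNoetherian.noetherian (LinearMap.ker f))
  let q : MvPolynomial (σ × Fin r) S :=
    bind₁ (fun i => ∑ j, C (f (Pi.single j 1)) * X (i, j)) g
  have hfs : ∀ v : Fin r → A, f v = ∑ j, f (Pi.single j 1) * algebraMap A S (v j) := by
    intro v
    conv_lhs => rw [pi_eq_sum_univ' v]
    rw [map_sum]
    refine Finset.sum_congr rfl fun j _ => ?_
    rw [map_smul, Algebra.smul_def, mul_comm]
  have hq : ∀ x : σ × Fin r → A, eval (fun i => algebraMap A S (x i)) q =
      eval (fun i => f (fun j => x (i, j))) g := by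
    intro x
    simp only [q]
    rw [← MvPolynomial.aeval_eq_eval, aeval_bind₁, ← MvPolynomial.aeval_eq_eval]
    congr 2
    ext i
    rw [hfs]
    simp
  obtain ⟨G, hG⟩ := lift_poly f hf q
  simp only [hq] at hG
  let E : Fin r → MvPolynomial ((σ × Fin r) ⊕ Fin l) A := fun k =>
    rename Sum.inl (G k) - ∑ j, X (Sum.inr j) * C (ρ j k)
  have hE : ∀ (y : (σ × Fin r) ⊕ Fin l → A) k, eval y (E k) =
      eval (fun i => y (Sum.inl i)) (G k) - ∑ j, y (Sum.inr j) * ρ j k := by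
    intro y k
    simp only [E, map_sub, eval_rename, map_sum, map_mul, eval_X, eval_C]
    rfl
  obtain ⟨c, e, hce⟩ := greenberg hw hC (Ideal.span (Set.range E))
  refine ⟨c, e, fun n a ha => ?_⟩
  choose x hx using fun i => hf (a i)
  obtain ⟨s, hs⟩ := ha
  obtain ⟨v, rfl⟩ := hf s
  have hker : (fun k => eval (fun i : σ × Fin r => x i.1 i.2) (G k)) - w ^ (c * n + e) • v ∈
      LinearMap.ker f := by
    rw [LinearMap.mem_ker, map_sub, hG, map_smul, Algebra.smul_def, map_pow, ← hs]
    simp only [hx, sub_self]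
  rw [← hρ] at hker
  obtain ⟨z, hz⟩ := (Submodule.mem_span_range_iff_exists_fun A).1 hker
  obtain ⟨y, hy1, hy2⟩ := hce n (Sum.elim (fun i => x i.1 i.2) z) (by
    have : Ideal.span (Set.range E) ≤ (Ideal.span {w ^ (c * n + e)}).comap
        (eval (Sum.elim (fun i => x i.1 i.2) z)) := by
      rw [Ideal.span_le]
      rintro _ ⟨k, rfl⟩
      rw [SetLike.mem_coe, Ideal.mem_comap, Ideal.mem_span_singleton, hE]
      have hzk := congrFun hz k
      simp only [Finset.sum_apply, Pi.smul_apply, Pi.sub_apply, smul_eq_mul] at hzk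
      simp only [Sum.elim_inl, Sum.elim_inr, hzk, sub_sub_cancel]
      exact dvd_mul_right _ _
    exact fun q hq => Ideal.mem_span_singleton.1 (this hq))
  refine ⟨fun i => f (fun j => y (Sum.inl (i, j))), ?_, ?_⟩
  · rw [← hG (fun i => y (Sum.inl i)), ← LinearMap.mem_ker, ← hρ,
      Submodule.mem_span_range_iff_exists_fun]
    refine ⟨fun j => y (Sum.inr j), ?_⟩
    ext k
    have := hy1 _ (Ideal.subset_span ⟨k, rfl⟩)
    rw [hE, sub_eq_zero] at this
    rw [this]
    simp
  · intro i
    choose d hd using fun j => hy2 (Sum.inl (i, j))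
    refine ⟨f d, ?_⟩
    rw [← hx i, ← map_sub, ← map_pow, ← Algebra.smul_def, ← map_smul]
    congr 1
    ext j
    exact hd j

lemma finite_of_quot {A S : Type*} [CommRing A] [CommRing S] [Algebra A S] {w : A}
    (hC : SeqComplete w) (hsep : ∀ x : S, (∀ n : ℕ, algebraMap A S w ^ n ∣ x) → x = 0)
    {r : ℕ} (e : Fin r → S) (h : ∀ x, ∃ a : Fin r → A, algebraMap A S w ∣ x - ∑ i, a i • e i) :
    Module.Finite A S := by
  choose a b hab using h
  have hspan : Submodule.span A (Set.range e) = ⊤ := by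
    rw [eq_top_iff]
    intro x _
    rw [Submodule.mem_span_range_iff_exists_fun]
    let X : ℕ → S := fun n => b^[n] x
    have hX : ∀ n, X n = ∑ i, a (X n) i • e i + algebraMap A S w * X (n + 1) := by
      intro n
      have : X (n + 1) = b (X n) := Function.iterate_succ_apply' b n x
      rw [this, ← hab]; ring
    let U : Fin r → ℕ → A := fun i n => ∑ k ∈ Finset.range n, w ^ k * a (X k) i
    have hU : ∀ n, x = ∑ i, U i n • e i + algebraMap A S w ^ n * X n := by
      intro n
      induction n with
      | zero => simp [U, X]
      | succ n ih =>
        have h1 : ∑ i, U i (n + 1) • e i = ∑ i, U i n • e i +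
            algebraMap A S w ^ n * ∑ i, a (X n) i • e i := by
          rw [Finset.mul_sum, ← Finset.sum_add_distrib]
          refine Finset.sum_congr rfl fun i _ => ?_
          simp only [U, Finset.sum_range_succ, add_smul, mul_smul]
          congr 1
          rw [Algebra.smul_def, map_pow]
        conv_lhs => rw [ih, hX n]
        rw [h1]; ring
    choose l hl using fun i => hC (U i) (fun n => by
      simp only [U, Finset.sum_range_succ, add_sub_cancel_left]
      exact dvd_mul_right _ _)
    refine ⟨l, ?_⟩
    rw [← sub_eq_zero]
    apply hsep
    intro n
    have h2 : ∑ i, l i • e i - x = ∑ i, (l i - U i n) • e i - algebraMap A S w ^ n * X n := by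
      conv_lhs => rw [hU n]
      simp only [sub_smul, Finset.sum_sub_distrib]; ring
    rw [h2]
    refine dvd_sub (Finset.dvd_sum fun i _ => ?_) (dvd_mul_right _ _)
    rw [Algebra.smul_def, ← map_pow]
    exact (map_dvd (algebraMap A S) (hl i n)).mul_right _
  exact ⟨⟨(Set.finite_range e).toFinset, by simpa using hspan⟩⟩

lemma exists_fin_span {A R : Type*} [CommRing A] [CommRing R] [IsNoetherianRing R] [Algebra A R]
    (m : Ideal R) (hm : ∀ x : R, ∃ a : A, x - algebraMap A R a ∈ m) (h : ℕ) :
    ∃ T : Finset R, ∀ x : R, x ∈ Submodule.span A (T : Set R) ⊔ (m ^ h).restrictScalars A := by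
  classical
  induction h with
  | zero => exact ⟨∅, fun x => Submodule.mem_sup_right (by simp)⟩
  | succ h ih =>
    obtain ⟨T, hT⟩ := ih
    obtain ⟨G, hG⟩ := IsNoetherian.noetherian (m ^ h)
    refine ⟨T ∪ G, fun x => ?_⟩
    have hle : (m ^ h).restrictScalars A ≤
        Submodule.span A (G : Set R) ⊔ (m ^ (h + 1)).restrictScalars A := by
      intro y hy
      have hy' : y ∈ Submodule.span R (G : Set R) := by rw [hG]; exact hy
      induction hy' using Submodule.span_induction with
      | mem y hyG => exact Submodule.mem_sup_left (Submodule.subset_span hyG)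
      | zero => exact zero_mem _
      | add y z hy1 hz1 h1 h2 =>
        exact add_mem (h1 (by rw [← hG]; exact hy1)) (h2 (by rw [← hG]; exact hz1))
      | smul r y hy1 h1 =>
        have hym : y ∈ m ^ h := by rw [← hG]; exact hy1
        obtain ⟨a, ha⟩ := hm r
        have : r • y = a • y + (r - algebraMap A R a) * y := by
          rw [Algebra.smul_def a y, smul_eq_mul]; ring
        rw [this]
        refine add_mem (Submodule.smul_mem _ _ (h1 hym)) (Submodule.mem_sup_right ?_)
        change _ ∈ m ^ (h + 1)
        rw [pow_succ']
        exact Ideal.mul_mem_mul ha hym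
    have h3 := (sup_le_sup_left hle (Submodule.span A (T : Set R))) (hT x)
    rw [← sup_assoc, ← Submodule.span_union] at h3
    simpa using h3

lemma exists_param {R : Type*} [CommRing R] [IsDomain R] [IsNoetherianRing R] [IsLocalRing R]
    (hdim : ringKrullDim R = 2) (t : R) (ht : t ≠ 0) :
    ∃ s ∈ maximalIdeal R, ∃ h : ℕ, maximalIdeal R ^ h ≤ Ideal.span {t} ⊔ Ideal.span {s} := by
  classical
  have hfin := (Ideal.span {t}).finite_minimalPrimes_of_isNoetherianRing R
  let Z : Finset (Ideal R) := hfin.toFinset.filter (· ≠ maximalIdeal R)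
  have hnot : ¬ ((maximalIdeal R : Set R) ⊆ ⋃ p ∈ (Z : Set (Ideal R)), (p : Set R)) := by
    intro hsub
    rw [Ideal.subset_union_prime (f := fun p : Ideal R => p) ⊥ ⊥] at hsub
    · obtain ⟨p, hp, hle⟩ := hsub
      have hp' : p ∈ (Ideal.span {t}).minimalPrimes ∧ p ≠ maximalIdeal R := by simpa [Z] using hp
      have : p.IsPrime := hp'.1.1.1
      exact hp'.2 (le_antisymm (le_maximalIdeal this.ne_top) hle)
    · intro p hp _ _
      have hp' : p ∈ (Ideal.span {t}).minimalPrimes ∧ p ≠ maximalIdeal R := by simpa [Z] using hp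
      exact hp'.1.1.1
  rw [Set.not_subset] at hnot
  obtain ⟨s, hs, hsn⟩ := hnot
  refine ⟨s, hs, ?_⟩
  apply Ideal.exists_pow_le_of_le_radical_of_fg _ (IsNoetherian.noetherian _)
  rw [Ideal.radical_eq_sInf, le_sInf_iff]
  rintro q ⟨hq, hqp⟩
  rw [sup_le_iff] at hq
  obtain ⟨p, hp, hpq⟩ := Ideal.exists_minimalPrimes_le hq.1
  have hpp : p.IsPrime := hp.1.1
  by_cases hpm : p = maximalIdeal R
  · exact hpm ▸ hpq
  have hsp : s ∉ p := fun hsp => hsn (by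
    simp only [Set.mem_iUnion]
    exact ⟨p, by simpa [Z] using ⟨hp, hpm⟩, hsp⟩)
  have hpq' : p < q := lt_of_le_of_ne hpq (fun h => hsp (by
    rw [h]; exact hq.2 (Ideal.mem_span_singleton_self s)))
  by_contra hqm
  have hqm' : q < maximalIdeal R := lt_of_le_of_ne (le_maximalIdeal hqp.ne_top)
    (fun h => hqm h.ge)
  have h0p : (⊥ : Ideal R) < p := bot_lt_iff_ne_bot.2 (fun h => ht (by
    have : t ∈ p := hp.1.2 (Ideal.mem_span_singleton_self t)
    rwa [h] at this))
  have hbot : (⊥ : Ideal R).IsPrime := Ideal.isPrime_bot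
  have e1 := Ideal.height_add_one_le_of_lt_of_isPrime h0p
  have e2 := Ideal.height_add_one_le_of_lt_of_isPrime hpq'
  have e3 := Ideal.height_add_one_le_of_lt_of_isPrime hqm'
  have e4 : ((maximalIdeal R).height : WithBot ℕ∞) = ((2 : ℕ∞) : WithBot ℕ∞) := by
    rw [IsLocalRing.maximalIdeal_height_eq_ringKrullDim, hdim]; rfl
  have e5 : (maximalIdeal R).height = 2 := WithBot.coe_injective e4
  rw [e5] at e3
  have e6 : (0 + 1 + 1 + 1 : ℕ∞) ≤ 2 := by
    refine le_trans ?_ e3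
    gcongr
    refine le_trans ?_ e2
    gcongr
    refine le_trans ?_ e1
    gcongr
    exact zero_le
  have e7 : ((3 : ℕ) : ℕ∞) ≤ ((2 : ℕ) : ℕ∞) := by
    refine le_trans (le_of_eq ?_) e6
    norm_num
  exact absurd (Nat.cast_le.1 e7) (by norm_num)

lemma exists_powerSeries_hom {R k : Type*} [CommRing R] [Field k] (m : Ideal R)
    [IsAdicComplete m R] (g : k →+* R) (s : R) (hs : s ∈ m) :
    ∃ f : PowerSeries k →+* R, f PowerSeries.X = s ∧ ∀ c, f (PowerSeries.C c) = g c := by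
  have hX : ∀ (n : ℕ) (p q : Polynomial k), (∀ d < n, p.coeff d = q.coeff d) →
      Ideal.Quotient.mk (m ^ n) (p.eval₂ g s) = Ideal.Quotient.mk (m ^ n) (q.eval₂ g s) := by
    intro n p q hpq
    have h1 : Polynomial.X ^ n ∣ p - q := by
      rw [Polynomial.X_pow_dvd_iff]
      intro d hd
      rw [Polynomial.coeff_sub, hpq d hd, sub_self]
    obtain ⟨r, hr⟩ := h1
    rw [Ideal.Quotient.eq, ← Polynomial.eval₂_sub, hr, Polynomial.eval₂_mul,
      Polynomial.eval₂_X_pow]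
    exact Ideal.mul_mem_right _ _ (Ideal.pow_mem_pow hs n)
  let f : (n : ℕ) → PowerSeries k →+* R ⧸ m ^ n := fun n =>
    { toFun := fun φ => Ideal.Quotient.mk (m ^ n) ((PowerSeries.trunc n φ).eval₂ g s)
      map_one' := by
        rw [hX n _ 1 (fun d hd => by
          rw [PowerSeries.coeff_trunc, if_pos hd, PowerSeries.coeff_one, Polynomial.coeff_one]
          )]
        simp
      map_zero' := by simp
      map_add' := fun a b => by simp [Polynomial.eval₂_add]
      map_mul' := fun a b => by
        rw [hX n _ (PowerSeries.trunc n a * PowerSeries.trunc n b) (fun d hd => by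
          rw [PowerSeries.coeff_trunc, if_pos hd,
            PowerSeries.coeff_mul_eq_coeff_trunc_mul_trunc _ _ hd, ← Polynomial.coe_mul,
            Polynomial.coeff_coe])]
        rw [Polynomial.eval₂_mul, map_mul] }
  have hf : ∀ {a b : ℕ} (hle : a ≤ b), (Ideal.Quotient.factorPow m hle).comp (f b) = f a := by
    intro a b hle
    ext φ
    change Ideal.Quotient.mk (m ^ a) ((PowerSeries.trunc b φ).eval₂ g s) =
      Ideal.Quotient.mk (m ^ a) ((PowerSeries.trunc a φ).eval₂ g s)
    apply hX
    intro d hd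
    rw [PowerSeries.coeff_trunc, PowerSeries.coeff_trunc, if_pos hd, if_pos (by omega)]
  have hsub : ∀ x y : R, (∀ n, Ideal.Quotient.mk (m ^ n) x = Ideal.Quotient.mk (m ^ n) y) → x = y := by
    intro x y hxy
    rw [← sub_eq_zero]
    apply IsHausdorff.haus (I := m) inferInstance
    intro n
    rw [SModEq.zero, smul_eq_mul, Ideal.mul_top]
    exact Ideal.Quotient.eq.1 (hxy n)
  refine ⟨IsAdicComplete.liftRingHom m f hf, hsub _ _ fun n => ?_, fun c => hsub _ _ fun n => ?_⟩
  · rw [IsAdicComplete.mk_liftRingHom]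
    change Ideal.Quotient.mk (m ^ n) ((PowerSeries.trunc n _).eval₂ g s) = _
    rw [hX n _ Polynomial.X (fun d hd => by
      rw [PowerSeries.coeff_trunc, if_pos hd, PowerSeries.coeff_X, Polynomial.coeff_X]
      simp [eq_comm])]
    simp
  · rw [IsAdicComplete.mk_liftRingHom]
    change Ideal.Quotient.mk (m ^ n) ((PowerSeries.trunc n _).eval₂ g s) = _
    rw [hX n _ (Polynomial.C c) (fun d hd => by
      rw [PowerSeries.coeff_trunc, if_pos hd, PowerSeries.coeff_C, Polynomial.coeff_C])]
    simp

lemma seqComplete_X (k : Type*) [Field k] : SeqComplete (PowerSeries.X : PowerSeries k) := by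
  intro u hu
  have hp : IsPrecomplete (Ideal.span {(PowerSeries.X : PowerSeries k)}) (PowerSeries k) := inferInstance
  obtain ⟨l, hl⟩ := hp.prec (f := u) (fun {a b} hab => by
    rw [smul_eq_mul, Ideal.mul_top, Ideal.span_singleton_pow, SModEq.sub_mem,
      Ideal.mem_span_singleton]
    rw [← neg_sub, dvd_neg]
    exact seq_dvd_of_le hu hab)
  refine ⟨l, fun n => ?_⟩
  have := hl n
  rw [smul_eq_mul, Ideal.mul_top, Ideal.span_singleton_pow, SModEq.sub_mem,
      Ideal.mem_span_singleton] at this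
  rw [← neg_sub, dvd_neg]
  exact this

/-- **Example.** Let `(R, m)` be a complete Noetherian local domain of dimension `2` containing
a field, `t ∈ R` nonzero and `g ∈ R[X₁,…,X_N]`.  Then the polynomial `f = g(X) + tY` admits an
Artin bound that is bounded above by a linear function of `n`. -/
theorem lap_of_g_add_tY
    (R : Type*) [CommRing R] [IsDomain R] [IsNoetherianRing R] [IsLocalRing R]
    [IsAdicComplete (maximalIdeal R) R]
    (K : Type*) [Field K] [Algebra K R]
    (hdim : ringKrullDim R = 2)
    (t : R) (ht : t ≠ 0) (N : ℕ) (g : MvPolynomial (Fin N) R) :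
    ∃ c e : ℕ, ∀ n : ℕ, ∀ a : Fin N → R, ∀ y : R,
      eval a g + t * y ∈ maximalIdeal R ^ (c * n + e) →
      ∃ (b : Fin N → R) (u : R), eval b g + t * u = 0 ∧
        (∀ j, a j - b j ∈ maximalIdeal R ^ n) ∧ y - u ∈ maximalIdeal R ^ n := by
  classical
  -- Artin-Rees for the ideal generated by `t`
  obtain ⟨k₀, hk₀⟩ : ∃ k₀ : ℕ, ∀ (n : ℕ) (z : R), t * z ∈ maximalIdeal R ^ (n + k₀) →
      z ∈ maximalIdeal R ^ n := by
    obtain ⟨k₀, hk₀⟩ := Ideal.exists_pow_inf_eq_pow_smul (maximalIdeal R) (Ideal.span {t})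
    refine ⟨k₀, fun n z hz => ?_⟩
    have h1 := hk₀ (n + k₀) (by omega)
    have h2 : t * z ∈ (maximalIdeal R ^ (n + k₀) • ⊤ ⊓ Ideal.span {t} : Ideal R) :=
      ⟨by simpa using hz, Ideal.mem_span_singleton.2 (dvd_mul_right _ _)⟩
    rw [h1, Nat.add_sub_cancel] at h2
    have h3 : t * z ∈ maximalIdeal R ^ n * Ideal.span {t} :=
      Ideal.mul_mono_right inf_le_right h2
    obtain ⟨r, hr, hrt⟩ := Ideal.mem_mul_span_singleton.1 h3
    rw [mul_comm] at hrt
    rw [← mul_left_cancel₀ ht hrt]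
    exact hr
  obtain ⟨s, hs, h, hh⟩ := exists_param hdim t ht
  obtain ⟨σ, hσ⟩ := exists_coeff_field' (K := K) (R := R)
  obtain ⟨f, hfX, hfC⟩ := exists_powerSeries_hom (maximalIdeal R) σ s hs
  let A := PowerSeries (ResidueField R)
  let : Algebra A R := f.toAlgebra
  have hfa : ∀ x, algebraMap A R x = f x := fun _ => rfl
  let S := R ⧸ Ideal.span {t}
  have hAS : algebraMap A S PowerSeries.X = Ideal.Quotient.mk (Ideal.span {t}) s := by
    rw [IsScalarTower.algebraMap_apply A R S, hfa, hfX]; rfl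
  have hw : Irreducible (PowerSeries.X : A) := PowerSeries.X_prime.irreducible
  have hC : SeqComplete (PowerSeries.X : A) := seqComplete_X _
  have hmap : (maximalIdeal R ^ h).map (Ideal.Quotient.mk (Ideal.span {t})) ≤
      Ideal.span {Ideal.Quotient.mk (Ideal.span {t}) s} := by
    refine (Ideal.map_mono hh).trans ?_
    rw [Ideal.map_sup, Ideal.map_span, Ideal.map_span, Set.image_singleton, Set.image_singleton,
      Ideal.Quotient.eq_zero_iff_mem.2 (Ideal.mem_span_singleton_self t)]
    simp
  have hfin : Module.Finite A S := by
    obtain ⟨T, hT⟩ := exists_fin_span (A := A) (maximalIdeal R) (fun x => by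
      refine ⟨PowerSeries.C (residue R x), ?_⟩
      rw [hfa, hfC, ← residue_eq_zero_iff, map_sub, hσ, sub_self]) h
    let e : Fin T.card → S := fun i => Ideal.Quotient.mk (Ideal.span {t}) (T.equivFin.symm i : R)
    refine finite_of_quot hC ?_ e ?_
    · intro x hx
      obtain ⟨x, rfl⟩ := Ideal.Quotient.mk_surjective x
      have hH : IsHausdorff (maximalIdeal R) S := inferInstance
      apply hH.haus
      intro n
      rw [SModEq.zero]
      obtain ⟨z, hz⟩ := hx n
      rw [hz, hAS, ← map_pow, ← smul_eq_mul]
      exact Submodule.smul_mem_smul (Ideal.pow_mem_pow hs n) (Submodule.mem_top (x := z))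
    · intro x
      obtain ⟨x, rfl⟩ := Ideal.Quotient.mk_surjective x
      obtain ⟨y, hy, z, hz, rfl⟩ := Submodule.mem_sup.1 (hT x)
      have hy2 : Ideal.Quotient.mk (Ideal.span {t}) y ∈ Submodule.span A (Set.range e) := by
        have : Submodule.span A (T : Set R) ≤
            (Submodule.span A (Set.range e)).comap (Ideal.Quotient.mkₐ A (Ideal.span {t})).toLinearMap := by
          rw [Submodule.span_le]
          intro v hv
          exact Submodule.subset_span ⟨T.equivFin ⟨v, hv⟩, by simp [e]⟩
        exact this hy
      obtain ⟨a, ha⟩ := (Submodule.mem_span_range_iff_exists_fun A).1 hy2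
      refine ⟨a, ?_⟩
      rw [ha, map_add, add_sub_cancel_left, hAS, ← Ideal.mem_span_singleton]
      exact hmap (Ideal.mem_map_of_mem _ hz)
  obtain ⟨c, e, hce⟩ := transfer hw hC (g.map (Ideal.Quotient.mk (Ideal.span {t})) : MvPolynomial (Fin N) S)
  have hmk : ∀ a : Fin N → R, Ideal.Quotient.mk (Ideal.span {t}) (eval a g) =
      eval (fun j => Ideal.Quotient.mk (Ideal.span {t}) (a j))
        (g.map (Ideal.Quotient.mk (Ideal.span {t}))) := by
    intro a
    rw [eval_map, eval₂_comp]
    rfl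
  refine ⟨h * c + 1, h * (c * k₀ + e) + k₀, fun n a y hay => ?_⟩
  have hβ : (h * c + 1) * n + (h * (c * k₀ + e) + k₀) = h * (c * (n + k₀) + e) + (n + k₀) := by ring
  rw [hβ] at hay
  obtain ⟨b', hb1, hb2⟩ := hce (n + k₀) (fun j => Ideal.Quotient.mk (Ideal.span {t}) (a j)) (by
    rw [← hmk, hAS]
    have h1 : Ideal.Quotient.mk (Ideal.span {t}) (eval a g) =
        Ideal.Quotient.mk (Ideal.span {t}) (eval a g + t * y) := by
      rw [map_add, map_mul, Ideal.Quotient.eq_zero_iff_mem.2 (Ideal.mem_span_singleton_self t)]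
      simp
    rw [h1, ← Ideal.mem_span_singleton, ← Ideal.span_singleton_pow]
    have h2 := Ideal.mem_map_of_mem (Ideal.Quotient.mk (Ideal.span {t}))
      (Ideal.pow_le_pow_right (Nat.le_add_right _ (n + k₀)) hay)
    rw [pow_mul, Ideal.map_pow] at h2
    exact Ideal.pow_right_mono hmap _ h2)
  choose d' hd' using hb2
  choose d hd using fun j => Ideal.Quotient.mk_surjective (d' j)
  let b : Fin N → R := fun j => a j - s ^ (n + k₀) * d j
  have hbb : (fun j => Ideal.Quotient.mk (Ideal.span {t}) (b j)) = b' := by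
    funext j
    simp only [b, map_sub, map_mul, map_pow, hd]
    rw [← hAS, ← hd' j, sub_sub_cancel]
  have hab : ∀ j, s ^ (n + k₀) ∣ a j - b j := fun j => by simp [b]
  have hgb : eval b g ∈ Ideal.span {t} := by
    rw [← Ideal.Quotient.eq_zero_iff_mem, hmk, hbb, hb1]
  obtain ⟨u', hu'⟩ := Ideal.mem_span_singleton.1 hgb
  refine ⟨b, -u', by rw [hu']; ring, fun j => ?_, ?_⟩
  · exact Ideal.pow_le_pow_right (Nat.le_add_right n k₀)
      (Ideal.mem_of_dvd _ (hab j) (Ideal.pow_mem_pow hs _))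
  · apply hk₀
    have h5 : t * (y - -u') = (eval a g + t * y) - (eval a g - eval b g) := by rw [hu']; ring
    rw [h5]
    refine sub_mem (Ideal.pow_le_pow_right (Nat.le_add_left _ _) hay) ?_
    exact Ideal.mem_of_dvd _ (eval_sub_dvd _ a b hab g) (Ideal.pow_mem_pow hs _)
end
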